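/- arXiv:1104.4412 — 2 statements merged into one kernel-verified Lean document; each statement's English description precedes it below -/
import Mathlib

section
/- There exists N such that the following holds for all n ≥ N. Let G be an (r_G/n)-pseudorandom graph on n vertices with r_G ≥ (log n)², and let H be an r_H-regular spanning subgraph of G with r_H even. Then the edge set of H can be partitioned into 2-factors F₁,…,F_{r_H/2} such that c(F₁) + … + c(F_{r_H/2}) ≤ 3n√(r_G·(log n)³), where c(F) denotes the number of cycles of the 2-factor F. -/
open scoped Classical
open SimpleGraph

namespace EDHC

/-- Degree of a vertex (as cardinality of its neighbour set). -/
noncomputable def deg {V : Type} (G : SimpleGraph V) (v : V) : ℕ := (G.neighborSet v).ncard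

/-- Minimum degree. -/
noncomputable def minDeg {V : Type} (G : SimpleGraph V) : ℕ := sInf (Set.range (deg G))

/-- Maximum degree. -/
noncomputable def maxDeg {V : Type} (G : SimpleGraph V) : ℕ := sSup (Set.range (deg G))

/-- Number of edges of `G` with both endpoints in `S`. -/
noncomputable def eIn {V : Type} (G : SimpleGraph V) (S : Set V) : ℕ :=
  {e ∈ G.edgeSet | ∀ v ∈ e, v ∈ S}.ncard

/-- Number of edges of `G` with one endpoint in `S` and the other in `T`. -/
noncomputable def eBtw {V : Type} (G : SimpleGraph V) (S T : Set V) : ℕ :=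
  {e ∈ G.edgeSet | ∃ a ∈ S, ∃ b ∈ T, e = s(a, b)}.ncard

/-- `G` is `(p, β)`-jumbled. -/
def IsJumbled {V : Type} (G : SimpleGraph V) (p β : ℝ) : Prop :=
  ∀ S : Set V, |(eIn G S : ℝ) - p * ((S.ncard : ℝ) * ((S.ncard : ℝ) - 1) / 2)| ≤ β * S.ncard

/-- `G` is strongly `2`-jumping. -/
def StronglyTwoJumping (n : ℕ) (G : SimpleGraph (Fin n)) : Prop :=
  ∀ T : Set (Fin n), T.Nonempty →
    (∑ v ∈ (Set.toFinite T).toFinset, (deg G v : ℝ)) / (T.ncard : ℝ) ≥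
      (minDeg G : ℝ) + min ((T.ncard : ℝ) - 1) ((Real.log n) ^ 2)

/-- `G` is `p`-pseudorandom. -/
def IsPseudorandom (n : ℕ) (G : SimpleGraph (Fin n)) (p : ℝ) : Prop :=
  IsJumbled G p (2 * Real.sqrt (n * p * (1 - p))) ∧
  (∀ S T : Set (Fin n), Disjoint S T →
    ((1 / (S.ncard : ℝ) + 1 / (T.ncard : ℝ)) * Real.log n / p ≥ 7 / 2 →
      (eBtw G S T : ℝ) ≤ 2 * ((S.ncard : ℝ) + (T.ncard : ℝ)) * Real.log n) ∧
    ((1 / (S.ncard : ℝ) + 1 / (T.ncard : ℝ)) * Real.log n / p ≤ 7 / 2 →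
      (eBtw G S T : ℝ) ≤ 7 * (S.ncard : ℝ) * (T.ncard : ℝ) * p)) ∧
  (∀ S : Set (Fin n),
    (Real.log n / ((S.ncard : ℝ) * p) ≥ 7 / 4 → (eIn G S : ℝ) ≤ 2 * (S.ncard : ℝ) * Real.log n) ∧
    (Real.log n / ((S.ncard : ℝ) * p) ≤ 7 / 4 → (eIn G S : ℝ) ≤ 7 * (S.ncard : ℝ) ^ 2 * p / 2)) ∧
  ((n : ℝ) * p - 2 * Real.sqrt ((n : ℝ) * p * Real.log n) ≤ (minDeg G : ℝ) ∧
    (minDeg G : ℝ) ≤ (n : ℝ) * p - 200 * Real.sqrt ((n : ℝ) * p * (1 - p)) ∧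
    (maxDeg G : ℝ) ≤ (n : ℝ) * p + 2 * Real.sqrt ((n : ℝ) * p * Real.log n)) ∧
  StronglyTwoJumping n G

/-- `G` is `u`-jumping. -/
def IsJumping (n : ℕ) (G : SimpleGraph (Fin n)) (u : ℝ) : Prop :=
  ∃ x₀ : Fin n, deg G x₀ = minDeg G ∧
    ∀ x : Fin n, x ≠ x₀ → (deg G x : ℝ) ≥ (minDeg G : ℝ) + u

/-- `C` is a Hamilton cycle (on the whole vertex set `Fin n`). -/
def IsHamCycle {n : ℕ} (C : SimpleGraph (Fin n)) : Prop :=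
  ∃ (v : Fin n) (w : C.Walk v v), w.IsHamiltonianCycle ∧ C.edgeSet = {e | e ∈ w.edges}

/-- `G` has property `H`. -/
def HasPropertyH (n : ℕ) (G : SimpleGraph (Fin n)) : Prop :=
  ∃ HC : Fin (minDeg G / 2) → SimpleGraph (Fin n),
    (∀ i, HC i ≤ G ∧ IsHamCycle (HC i)) ∧
    (∀ i j, i ≠ j → Disjoint (HC i).edgeSet (HC j).edgeSet) ∧
    (Odd (minDeg G) →
      ∃ M : SimpleGraph (Fin n), M ≤ G ∧ (∀ v, deg M v ≤ 1) ∧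
        M.edgeSet.ncard = n / 2 ∧ ∀ i, Disjoint M.edgeSet (HC i).edgeSet)

/-- Probability of the event `A` under the binomial random graph `G_{n,p}`. -/
noncomputable def gnpProb (n : ℕ) (p : ℝ) (A : SimpleGraph (Fin n) → Prop) : ℝ :=
  ∑ G : SimpleGraph (Fin n),
    if A G then p ^ G.edgeSet.ncard * (1 - p) ^ (n.choose 2 - G.edgeSet.ncard) else 0


/-- Number of cycles of a 2-regular graph = number of connected components. -/
noncomputable def numCycles {V : Type} (F : SimpleGraph V) : ℕ := Nat.card F.ConnectedComponent

/-- `N` is a perfect matching on the whole vertex set. -/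
def IsPerfectMatchingGraph {n : ℕ} (N : SimpleGraph (Fin n)) : Prop :=
  ∀ v, ((N.neighborSet v).ncard) = 1

/-- `N` is a perfect pseudomatching: one vertex of degree 2, all others of degree 1. -/
def IsPerfectPseudomatching {n : ℕ} (N : SimpleGraph (Fin n)) : Prop :=
  ∃ w, ((N.neighborSet w).ncard) = 2 ∧ ∀ v, v ≠ w → ((N.neighborSet v).ncard) = 1

/-- A set of edges forms a matching (no two distinct edges share a vertex). -/
def IsMatchingSet {n : ℕ} (E : Set (Sym2 (Fin n))) : Prop :=
  ∀ e ∈ E, ∀ f ∈ E, e ≠ f → ∀ v : Fin n, v ∈ e → v ∉ f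

/-- Number of cycles (orbits, including fixed points) of a permutation. -/
noncomputable def cycleCount {α : Type} (σ : Equiv.Perm α) : ℕ :=
  Nat.card (Quotient (⟨σ.SameCycle,
    ⟨fun x => Equiv.Perm.SameCycle.refl σ x, fun h => h.symm, fun h h' => h.trans h'⟩⟩ : Setoid α))

/-- Edges of the bipartite graph given by the relation `R` between `S` and `T`. -/
noncomputable def eBip {n : ℕ} (R : Fin n → Fin n → Prop) (S T : Set (Fin n)) : ℕ :=
  {q : Fin n × Fin n | q.1 ∈ S ∧ q.2 ∈ T ∧ R q.1 q.2}.ncard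

/-- One rotation of a path (represented as a list of vertices), with new edge from `H`
and pivot in `Q`. -/
def RotStep {V : Type} (H : SimpleGraph V) (Q : Set V) (l l' : List V) : Prop :=
  ∃ (x : V) (a : List V) (p : V) (b : List V),
    l = (x :: a) ++ p :: b ∧ l' = (x :: a).reverse ++ p :: b ∧ p ∈ Q ∧ H.Adj x p

/-- `v` is `(H, Q, τ)`-reachable from the path `l`. -/
def ReachableVert {V : Type} (H : SimpleGraph V) (Q : Set V) (τ : ℕ) (l : List V) (v : V) : Prop :=
  ∃ (k : ℕ) (f : ℕ → List V), k ≤ τ ∧ f 0 = l ∧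
    (∀ i < k, RotStep H Q (f i) (f (i + 1))) ∧ (f k).head? = some v

/-- External neighbourhood. -/
def extNbhd {V : Type} (H : SimpleGraph V) (S : Set V) : Set V :=
  (⋃ x ∈ S, H.neighborSet x) \ S

end EDHC

namespace EDHC

open Finset

/-- Two fixed-point-free involutions admit a common alternating two-colouring. -/
lemma exists_alternating_coloring {E : Type*} [Finite E] (a b : Equiv.Perm E)
    (ha : ∀ e, a (a e) = e) (hb : ∀ e, b (b e) = e) (ha' : ∀ e, a e ≠ e) (hb' : ∀ e, b e ≠ e) :
    ∃ c : E → Bool, ∀ e, c (a e) ≠ c e ∧ c (b e) ≠ c e := by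
  set π : Equiv.Perm E := a * b with hπ
  have haa : a * a = 1 := Equiv.ext ha
  have hbb : b * b = 1 := Equiv.ext hb
  have hainv : a⁻¹ = a := inv_eq_of_mul_eq_one_left haa
  have hbinv : b⁻¹ = b := inv_eq_of_mul_eq_one_left hbb
  have hconj : ∀ k : ℤ, ∀ e, a ((π ^ k) e) = (π ^ (-k)) (a e) := by
    intro k e
    have h1 : a * π * a⁻¹ = π⁻¹ := by
      rw [hπ, mul_inv_rev, hainv, hbinv, ← mul_assoc, haa, one_mul]
    have h2 : a * π ^ k * a⁻¹ = π ^ (-k) := by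
      rw [← conj_zpow, h1, inv_zpow, zpow_neg]
    have h3 : a * π ^ k = π ^ (-k) * a := by
      rw [← h2, inv_mul_cancel_right]
    exact congrArg (fun f : Equiv.Perm E => f e) h3
  have hba : ∀ e, b e = a (π e) := by
    intro e; simp [hπ, ha]
  have hne : ∀ e, ¬ π.SameCycle e (a e) := by
    rintro e ⟨k, hk⟩
    rcases Int.even_or_odd' k with ⟨j, rfl | rfl⟩
    · apply ha' ((π ^ j) e)
      rw [hconj, ← hk, ← Equiv.Perm.mul_apply, ← zpow_add]
      congr 2; ring
    · apply hb' ((π ^ j) e)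
      have h1 : π ((π ^ j) e) = (π ^ (1 + j)) e := by rw [zpow_one_add]; rfl
      rw [hba, h1, hconj, ← hk, ← Equiv.Perm.mul_apply, ← zpow_add]
      congr 2; ring
  have hrel : ∀ e f, π.SameCycle e f → π.SameCycle (a e) (a f) := by
    rintro e f ⟨k, rfl⟩
    exact ⟨-k, (hconj k e).symm⟩
  have hbs : ∀ e, π.SameCycle (b e) (a e) := by
    intro e
    rw [hba]
    exact hrel _ _ ⟨-1, by simp⟩
  obtain ⟨N, ⟨φ⟩⟩ := Finite.exists_equiv_fin E
  let r : E → Fin N := fun e => φ (Quotient.out (Quotient.mk (Equiv.Perm.SameCycle.setoid π) e))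
  have hr : ∀ e f, r e = r f ↔ π.SameCycle e f := by
    intro e f
    simp only [r, φ.injective.eq_iff, Quotient.out_inj]
    exact Quotient.eq
  refine ⟨fun e => decide (r e < r (a e)), fun e => ?_⟩
  have h1 : r e ≠ r (a e) := fun h => hne e ((hr _ _).1 h)
  have h2 : r (b e) = r (a e) := (hr _ _).2 (hbs e)
  have h3 : r (a (b e)) = r e := by
    rw [(hr _ _).2 (hrel _ _ (hbs e)), ha]
  simp only [ha, h2, h3, ne_eq, decide_eq_decide]
  constructor <;> · intro h; omega

/-- The partner of `e` under the pairings encoded by labellings of the fibres of `f`. -/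
noncomputable def partner {E A : Type*} (f : E → A) {h : ℕ}
    (L : ∀ a, {e // f e = a} ≃ Fin h × Bool) (e : E) : E :=
  ((L (f e)).symm ((L (f e) ⟨e, rfl⟩).1, !(L (f e) ⟨e, rfl⟩).2)).1

lemma partner_coe {E A : Type*} (f : E → A) {h : ℕ}
    (L : ∀ a, {e // f e = a} ≃ Fin h × Bool) (a : A) (x : {e // f e = a}) :
    partner f L x.1 = ((L a).symm ((L a x).1, !(L a x).2)).1 := by
  obtain ⟨e, rfl⟩ := x
  rfl

lemma partner_partner {E A : Type*} (f : E → A) {h : ℕ}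
    (L : ∀ a, {e // f e = a} ≃ Fin h × Bool) (e : E) : partner f L (partner f L e) = e := by
  conv_lhs => rw [partner_coe f L (f e) ⟨e, rfl⟩, partner_coe]
  simp

lemma partner_ne {E A : Type*} (f : E → A) {h : ℕ}
    (L : ∀ a, {e // f e = a} ≃ Fin h × Bool) (e : E) : partner f L e ≠ e := by
  intro h
  have h1 : (L (f e)).symm ((L (f e) ⟨e, rfl⟩).1, !(L (f e) ⟨e, rfl⟩).2) = ⟨e, rfl⟩ :=
    Subtype.ext h
  rw [Equiv.symm_apply_eq] at h1
  have := congrArg Prod.snd h1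
  simp at this

/-- A colouring is compatible with a labelling if labels `(i, true)`, `(i, false)` always carry
different colours. -/
def Compatible {X : Type*} {h : ℕ} (c : X → Bool) (L : X ≃ Fin h × Bool) : Prop :=
  ∀ i, c (L.symm (i, true)) ≠ c (L.symm (i, false))

lemma compatible_of_partner {E A : Type*} (f : E → A) {h : ℕ}
    (L : ∀ a, {e // f e = a} ≃ Fin h × Bool) (c : E → Bool) (hc : ∀ e, c (partner f L e) ≠ c e)
    (a : A) : Compatible (fun x : {e // f e = a} => c x.1) (L a) := by
  intro i
  have := hc ((L a).symm (i, false)).1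
  rw [partner_coe] at this
  simpa using this

lemma Compatible.card_eq {X : Type*} [Fintype X] {h : ℕ} {c : X → Bool} {L : X ≃ Fin h × Bool}
    (hc : Compatible c L) (t : Bool) : Fintype.card {x // c x = t} = h := by
  have e : {x // c x = t} ≃ Fin h :=
    { toFun := fun x => (L x.1).1
      invFun := fun i => if hi : c (L.symm (i, true)) = t then ⟨L.symm (i, true), hi⟩ else
        ⟨L.symm (i, false), by
          have := hc i
          revert this hi
          cases c (L.symm (i, true)) <;> cases c (L.symm (i, false)) <;> cases t <;> simp⟩
      left_inv := by
        rintro ⟨x, hx⟩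
        obtain ⟨⟨i, s⟩, rfl⟩ := L.symm.surjective x
        have := hc i
        cases s
        · have h' : ¬ c (L.symm (i, true)) = t := by rw [← hx]; exact this
          simp [h']
        · simp [hx]
      right_inv := by
        intro i
        by_cases hi : c (L.symm (i, true)) = t <;> simp [hi] }
  simpa using Fintype.card_congr e

lemma card_compatible_le {X : Type*} [Fintype X] {h : ℕ} (c : X → Bool)
    (hc : ∀ t, Fintype.card {x // c x = t} = h) :
    Nat.card {L : X ≃ Fin h × Bool // Compatible c L} ≤ 2 ^ h * (h.factorial * h.factorial) := by
  have hinj : ∀ (t : Bool) (L : X ≃ Fin h × Bool), Compatible c L →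
      Function.Injective (fun x : {x // c x = t} => (L x.1).1) := by
    rintro t L hL ⟨x, hx⟩ ⟨y, hy⟩ hxy
    obtain ⟨⟨i, s⟩, rfl⟩ := L.symm.surjective x
    obtain ⟨⟨j, s'⟩, rfl⟩ := L.symm.surjective y
    simp only [Equiv.apply_symm_apply] at hxy
    subst hxy
    have := hL i
    cases s <;> cases s' <;> simp_all
  let F : {L : X ≃ Fin h × Bool // Compatible c L} →
      (Fin h → Bool) × (({x // c x = true} ↪ Fin h) × ({x // c x = false} ↪ Fin h)) :=
    fun L => (fun i => c (L.1.symm (i, true)),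
      ⟨fun x => (L.1 x.1).1, hinj true L.1 L.2⟩, ⟨fun x => (L.1 x.1).1, hinj false L.1 L.2⟩)
  have hsnd : ∀ L : {L : X ≃ Fin h × Bool // Compatible c L}, ∀ x,
      (L.1 x).2 = decide (c x = c (L.1.symm ((L.1 x).1, true))) := by
    rintro ⟨L, hL⟩ x
    obtain ⟨⟨i, s⟩, rfl⟩ := L.symm.surjective x
    have := hL i
    cases s
    · simp [this.symm]
    · simp
  have hF : Function.Injective F := by
    intro L L' hLL
    apply Subtype.ext
    apply Equiv.ext
    intro x
    simp only [F, Prod.mk.injEq] at hLL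
    obtain ⟨h1, h2, h3⟩ := hLL
    have hfst : (L.1 x).1 = (L'.1 x).1 := by
      cases hx : c x
      · exact DFunLike.congr_fun h3 ⟨x, hx⟩
      · exact DFunLike.congr_fun h2 ⟨x, hx⟩
    apply Prod.ext hfst
    rw [hsnd, hsnd, ← hfst]
    have := congrFun h1 (L.1 x).1
    rw [this]
  have := Nat.card_le_card_of_injective F hF
  refine this.trans (le_of_eq ?_)
  simp only [Nat.card_eq_fintype_card, Fintype.card_prod, Fintype.card_embedding_eq, hc,
    Fintype.card_fin, Nat.descFactorial_self, Fintype.card_pi, Fintype.card_bool,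
    Finset.prod_const, Finset.card_univ]

/-- If every choice of pairings has a compatible colouring, then there are many balanced
colourings. -/
lemma pow_factorial_le_card_balanced {E U : Type*} [Fintype E] [Fintype U] (P : U → E → Prop)
    (h : ℕ) (hP : ∀ u, Fintype.card {e // P u e} = 2 * h)
    (hex : ∀ L : ∀ u, {e // P u e} ≃ Fin h × Bool, ∃ c : E → Bool, ∀ u,
      Compatible (fun x : {e // P u e} => c x.1) (L u)) :
    (2 * h).factorial ^ Fintype.card U ≤
      Nat.card {c : E → Bool // ∀ u t, Fintype.card {x : {e // P u e} // c x.1 = t} = h} *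
        (2 ^ h * (h.factorial * h.factorial)) ^ Fintype.card U := by
  choose C hC using hex
  let F : (∀ u, {e // P u e} ≃ Fin h × Bool) →
      Σ c : {c : E → Bool // ∀ u t, Fintype.card {x : {e // P u e} // c x.1 = t} = h},
        ∀ u, {L : {e // P u e} ≃ Fin h × Bool // Compatible (fun x : {e // P u e} => c.1 x.1) L} :=
    fun L => ⟨⟨C L, fun u t => (hC L u).card_eq t⟩, fun u => ⟨L u, hC L u⟩⟩
  have hF : Function.Injective F := by
    intro L L' hLL
    have : ∀ u, ((F L).2 u).1 = ((F L').2 u).1 := by rw [hLL]; intro u; rfl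
    exact funext this
  have h1 := Nat.card_le_card_of_injective F hF
  have h2 : Nat.card (∀ u, {e // P u e} ≃ Fin h × Bool) =
      (2 * h).factorial ^ Fintype.card U := by
    rw [Nat.card_eq_fintype_card, Fintype.card_pi, Finset.prod_congr rfl
      (g := fun _ => (2 * h).factorial), Finset.prod_const, Finset.card_univ]
    intro u _
    have e : {e // P u e} ≃ Fin h × Bool := Fintype.equivOfCardEq (by simp [hP, mul_comm])
    rw [Fintype.card_equiv e, hP]
  rw [← h2]
  refine h1.trans ?_
  rw [Nat.card_sigma, Nat.card_eq_fintype_card, ← smul_eq_mul, ← Finset.card_univ]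
  apply Finset.sum_le_card_nsmul
  intro c _
  rw [Nat.card_pi, ← Finset.card_univ]
  exact Finset.prod_le_pow_card _ _ _ fun u _ => card_compatible_le _ (c.2 u)

/-- The number of cycles of a permutation, fixed points included. -/
noncomputable def numOrbits {V : Type*} (σ : Equiv.Perm V) : ℕ :=
  Nat.card (Quotient (Equiv.Perm.SameCycle.setoid σ))

section Order

variable {V : Type*} {N : ℕ}

/-- `v` comes last, in the order `τ`, among the vertices of its `σ`-cycle. -/
def IsLast (τ : V ≃ Fin N) (σ : Equiv.Perm V) (v : V) : Prop :=
  ∀ u, σ.SameCycle v u → τ u ≤ τ v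

/-- The number of elements of `D v` still available as image of `v` when the values of `σ`
are revealed in the order `τ`. -/
def numAvail (D : V → Finset V) (τ : V ≃ Fin N) (σ : Equiv.Perm V) (v : V) : ℕ :=
  #{w ∈ D v | τ v ≤ τ (σ.symm w)}

/-- The probability-like weight of revealing `σ v`. -/
noncomputable def stepWeight (D : V → Finset V) (τ : V ≃ Fin N) (σ : Equiv.Perm V) (v : V) : ℝ :=
  (if IsLast τ σ v then 2 else 1) / (numAvail D τ σ v + 1)

lemma stepWeight_pos (D : V → Finset V) (τ : V ≃ Fin N) (σ : Equiv.Perm V) (v : V) :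
    0 < stepWeight D τ σ v := by
  unfold stepWeight; split_ifs <;> positivity

lemma numAvail_congr (D : V → Finset V) (τ : V ≃ Fin N) {σ σ' : Equiv.Perm V} {v : V}
    (h : ∀ u, τ u < τ v → σ u = σ' u) : numAvail D τ σ v = numAvail D τ σ' v := by
  unfold numAvail
  congr 1
  apply filter_congr
  intro w _
  rw [← not_lt, ← not_lt, not_iff_not]
  constructor
  · intro hw
    have := h _ hw
    rw [Equiv.apply_symm_apply] at this
    rwa [this, Equiv.symm_apply_apply]
  · intro hw
    have := h _ hw
    rw [Equiv.apply_symm_apply] at this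
    rwa [← this, Equiv.symm_apply_apply]

variable [Fintype V] [DecidableEq V]

lemma IsLast.apply_eq {τ : V ≃ Fin N} {σ σ' : Equiv.Perm V} {v : V}
    (h : ∀ u, τ u < τ v → σ u = σ' u) (hσ : IsLast τ σ v) (hσ' : IsLast τ σ' v) :
    σ v = σ' v := by
  have hlt : ∀ ρ : Equiv.Perm V, IsLast τ ρ v → ∀ u, ρ.SameCycle v u → u ≠ v → τ u < τ v :=
    fun ρ hρ u hu hne => lt_of_le_of_ne (hρ u hu) fun he => hne (τ.injective he)
  have hex : ∃ j : ℕ, (σ ^ j) (σ v) = v := by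
    have : σ.SameCycle (σ v) v := (Equiv.Perm.SameCycle.refl σ v).apply_left
    obtain ⟨j, -, hj⟩ := this.exists_pow_eq'
    exact ⟨j, hj⟩
  have hpow : ∀ i ≤ Nat.find hex, (σ' ^ i) (σ v) = (σ ^ i) (σ v) := by
    intro i
    induction i with
    | zero => simp
    | succ i ih =>
      intro hi
      rw [pow_succ', pow_succ', Equiv.Perm.mul_apply, Equiv.Perm.mul_apply, ih (by omega)]
      refine (h _ (hlt σ hσ _ ?_ (Nat.find_min hex (by omega)))).symm
      simpa using Equiv.Perm.SameCycle.refl σ v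
  have hcyc : σ'.SameCycle v (σ v) := by
    refine Equiv.Perm.SameCycle.symm ⟨(Nat.find hex : ℕ), ?_⟩
    rw [zpow_natCast, hpow _ le_rfl, Nat.find_spec hex]
  by_contra hne
  have hu : σ'.symm (σ v) ≠ v := by
    intro he
    exact hne ((Equiv.symm_apply_eq _).1 he)
  have h1 := h _ (hlt σ' hσ' (σ'.symm (σ v)) (by
    rw [← Equiv.Perm.inv_def]; simpa using hcyc) hu)
  rw [Equiv.apply_symm_apply] at h1
  exact hu (σ.injective h1)

lemma numOrbits_le_card_isLast (τ : V ≃ Fin N) (σ : Equiv.Perm V) :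
    numOrbits σ ≤ #{v | IsLast τ σ v} := by
  have : Function.Surjective (fun v : {v // IsLast τ σ v} =>
      Quotient.mk (Equiv.Perm.SameCycle.setoid σ) v.1) := by
    intro q
    induction q using Quotient.inductionOn with
    | h v =>
      obtain ⟨u, hu, hmax⟩ := exists_max_image ({u | σ.SameCycle v u} : Finset V) τ
        ⟨v, by simpa using Equiv.Perm.SameCycle.refl σ v⟩
      simp only [mem_filter, mem_univ, true_and] at hu hmax
      exact ⟨⟨u, fun x hx => hmax x (hu.trans hx)⟩, Quotient.sound hu.symm⟩
  refine (Nat.card_le_card_of_surjective _ this).trans (le_of_eq ?_)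
  rw [Nat.card_eq_fintype_card, Fintype.card_subtype]

lemma sum_prod_stepWeight_le_one_aux (D : V → Finset V) (τ : V ≃ Fin N) (k : ℕ) :
    ∀ t, t + k = N → ∀ σ₀ : Equiv.Perm V,
      ∑ σ : Equiv.Perm V with (∀ v, σ v ∈ D v) ∧ ∀ u, (τ u : ℕ) < t → σ u = σ₀ u,
        ∏ v with t ≤ (τ v : ℕ), stepWeight D τ σ v ≤ 1 := by
  induction k with
  | zero =>
    intro t ht σ₀
    have hsub : ({σ : Equiv.Perm V | (∀ v, σ v ∈ D v) ∧ ∀ u, (τ u : ℕ) < t → σ u = σ₀ u} :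
        Finset (Equiv.Perm V)) ⊆ {σ₀} := by
      intro σ hσ
      simp only [mem_filter, mem_univ, true_and] at hσ
      rw [mem_singleton]
      exact Equiv.ext fun u => hσ.2 u (by have := (τ u).2; omega)
    refine (sum_le_sum_of_subset_of_nonneg hsub
      fun σ _ _ => prod_nonneg fun v _ => (stepWeight_pos D τ σ v).le).trans ?_
    rw [sum_singleton, prod_eq_one]
    intro v hv
    simp only [mem_filter, mem_univ, true_and] at hv
    have := (τ v).2
    omega
  | succ k ih =>
    intro t ht σ₀
    set v : V := τ.symm ⟨t, by omega⟩ with hv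
    have hτv : (τ v : ℕ) = t := by simp [hv]
    have hlt : ∀ u, τ u < τ v ↔ (τ u : ℕ) < t := by
      intro u; rw [Fin.lt_def, hτv]
    set C : Finset (Equiv.Perm V) :=
      {σ | (∀ v, σ v ∈ D v) ∧ ∀ u, (τ u : ℕ) < t → σ u = σ₀ u} with hC
    have hCmem : ∀ σ, σ ∈ C ↔ (∀ v, σ v ∈ D v) ∧ ∀ u, (τ u : ℕ) < t → σ u = σ₀ u := by
      intro σ; simp [hC]
    set A : Finset V := {w ∈ D v | τ v ≤ τ (σ₀.symm w)} with hA
    have hav : ∀ σ ∈ C, numAvail D τ σ v = #A := by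
      intro σ hσ
      rw [numAvail_congr D τ (σ' := σ₀) fun u hu => ((hCmem σ).1 hσ).2 u ((hlt u).1 hu)]
      rfl
    have hmaps : ∀ σ ∈ C, σ v ∈ A := by
      intro σ hσ
      have h1 := (hCmem σ).1 hσ
      rw [hA, mem_filter]
      refine ⟨h1.1 v, ?_⟩
      by_contra hcon
      push Not at hcon
      have h2 := h1.2 _ ((hlt _).1 hcon)
      rw [Equiv.apply_symm_apply, σ.injective.eq_iff] at h2
      rw [h2] at hcon
      exact lt_irrefl _ hcon
    have hfilter : ({u | t ≤ (τ u : ℕ)} : Finset V) =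
        insert v ({u | t + 1 ≤ (τ u : ℕ)} : Finset V) := by
      ext u
      simp only [mem_filter, mem_univ, true_and, mem_insert]
      constructor
      · intro hu
        rcases hu.eq_or_lt with h | h
        · left; rw [hv, Equiv.eq_symm_apply]; exact Fin.ext h.symm
        · right; exact h
      · rintro (rfl | h)
        · exact hτv.ge
        · omega
    have hnot : v ∉ ({u | t + 1 ≤ (τ u : ℕ)} : Finset V) := by simp [hτv]
    set B : Finset V := {w ∈ A | ∃ σ ∈ C, σ v = w ∧ IsLast τ σ v} with hB
    have hBcard : #B ≤ 1 := by
      rw [card_le_one]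
      intro w hw w' hw'
      rw [hB, mem_filter] at hw hw'
      obtain ⟨-, σ, hσ, rfl, hl⟩ := hw
      obtain ⟨-, σ', hσ', rfl, hl'⟩ := hw'
      refine IsLast.apply_eq (fun u hu => ?_) hl hl'
      rw [((hCmem σ).1 hσ).2 u ((hlt u).1 hu), ((hCmem σ').1 hσ').2 u ((hlt u).1 hu)]
    rw [← sum_fiberwise_of_maps_to hmaps]
    have hfib : ∀ w ∈ A, ∑ σ ∈ C with σ v = w, ∏ u with t ≤ (τ u : ℕ), stepWeight D τ σ u ≤
        (1 + if w ∈ B then 1 else 0) / ((#A : ℝ) + 1) := by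
      intro w hw
      rcases ({σ ∈ C | σ v = w}).eq_empty_or_nonempty with he | ⟨σ₁, hσ₁⟩
      · rw [he, sum_empty]; positivity
      · rw [mem_filter] at hσ₁
        have hcl : ({σ ∈ C | σ v = w} : Finset (Equiv.Perm V)) =
            ({σ | (∀ v, σ v ∈ D v) ∧ ∀ u, (τ u : ℕ) < t + 1 → σ u = σ₁ u} :
              Finset (Equiv.Perm V)) := by
          ext σ
          simp only [mem_filter, mem_univ, true_and, hCmem]
          have h1 := ((hCmem σ₁).1 hσ₁.1).2
          constructor
          · rintro ⟨⟨h2, h3⟩, h4⟩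
            refine ⟨h2, fun u hu => ?_⟩
            rcases (Nat.lt_succ_iff.1 hu).eq_or_lt with h | h
            · have : u = v := by rw [hv, Equiv.eq_symm_apply]; exact Fin.ext h
              rw [this, h4, hσ₁.2]
            · rw [h3 u h, h1 u h]
          · rintro ⟨h2, h3⟩
            refine ⟨⟨h2, fun u hu => ?_⟩, ?_⟩
            · rw [h3 u (by omega), h1 u hu]
            · rw [h3 v (by omega), hσ₁.2]
        calc ∑ σ ∈ C with σ v = w, ∏ u with t ≤ (τ u : ℕ), stepWeight D τ σ u
            ≤ ∑ σ ∈ C with σ v = w, (1 + if w ∈ B then 1 else 0) / ((#A : ℝ) + 1) *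
                ∏ u with t + 1 ≤ (τ u : ℕ), stepWeight D τ σ u := by
              apply sum_le_sum
              intro σ hσ
              rw [mem_filter] at hσ
              rw [hfilter, prod_insert hnot]
              apply mul_le_mul_of_nonneg_right _
                (prod_nonneg fun v _ => (stepWeight_pos D τ σ v).le)
              unfold stepWeight
              rw [hav σ hσ.1]
              apply div_le_div_of_nonneg_right _ (by positivity)
              by_cases hl : IsLast τ σ v
              · have : w ∈ B := by
                  rw [hB, mem_filter]; exact ⟨hw, σ, hσ.1, hσ.2, hl⟩
                rw [if_pos hl, if_pos this]; norm_num
              · rw [if_neg hl]; split_ifs <;> norm_num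
          _ ≤ (1 + if w ∈ B then 1 else 0) / ((#A : ℝ) + 1) * 1 := by
              rw [← mul_sum]
              apply mul_le_mul_of_nonneg_left _ (by positivity)
              rw [hcl]
              exact ih (t + 1) (by omega) σ₁
          _ = _ := mul_one _
    refine (sum_le_sum hfib).trans ?_
    rw [← sum_div, div_le_one (by positivity), sum_add_distrib]
    have : ∑ w ∈ A, (if w ∈ B then (1 : ℝ) else 0) = #B := by
      rw [← sum_filter, sum_const, nsmul_eq_mul, mul_one]
      congr 2
      ext w
      simp only [hB, mem_filter]
      tauto
    rw [this, sum_const, nsmul_eq_mul, mul_one]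
    have : (#B : ℝ) ≤ 1 := by exact_mod_cast hBcard
    linarith

lemma sum_prod_stepWeight_le_one (D : V → Finset V) (τ : V ≃ Fin N) :
    ∑ σ : Equiv.Perm V with ∀ v, σ v ∈ D v, ∏ v, stepWeight D τ σ v ≤ 1 := by
  simpa using sum_prod_stepWeight_le_one_aux D τ N 0 (zero_add N) 1

end Order

/-- The ranks of the elements of a finite set run through `1, …, #A`. -/
lemma sum_rank {V β : Type*} [LinearOrder β] [DecidableEq V] (τ : V → β)
    (hτ : Function.Injective τ) (φ : ℕ → ℝ) (A : Finset V) :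
    ∑ u ∈ A, φ #{x ∈ A | τ u ≤ τ x} = ∑ j ∈ range #A, φ (j + 1) := by
  induction A using Finset.induction_on_min_value τ with
  | empty => simp
  | insert a s ha hmin ih =>
    rw [sum_insert ha, card_insert_of_notMem ha, sum_range_succ, ← ih, add_comm]
    congr 1
    · apply sum_congr rfl
      intro u hu
      have : ¬ τ u ≤ τ a := by
        intro h
        have := hτ (le_antisymm h (hmin u hu))
        exact ha (this ▸ hu)
      rw [filter_insert, if_neg this]
    · rw [filter_insert, if_pos le_rfl, filter_true_of_mem hmin, card_insert_of_notMem ha]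

section Bregman

variable {V : Type*} [Fintype V] [DecidableEq V]

/-- For a uniformly random order, the rank of an element of `A` is uniform. -/
lemma card_mul_sum_rank (φ : ℕ → ℝ) (A : Finset V) (v : V) (hv : v ∈ A) :
    (#A : ℝ) * ∑ τ : V ≃ Fin (Fintype.card V), φ #{x ∈ A | τ v ≤ τ x} =
      Fintype.card (V ≃ Fin (Fintype.card V)) * ∑ j ∈ range #A, φ (j + 1) := by
  have hsymm : ∀ u ∈ A, ∑ τ : V ≃ Fin (Fintype.card V), φ #{x ∈ A | τ u ≤ τ x} =
      ∑ τ : V ≃ Fin (Fintype.card V), φ #{x ∈ A | τ v ≤ τ x} := by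
    intro u hu
    refine Fintype.sum_equiv (Equiv.equivCongr (Equiv.swap u v) (Equiv.refl _)) _ _ ?_
    intro τ
    congr 1
    refine card_bij (fun x _ => Equiv.swap u v x) ?_ ?_ ?_
    · intro x hx
      simp only [mem_filter] at hx ⊢
      refine ⟨?_, by simpa [Equiv.equivCongr] using hx.2⟩
      rw [Equiv.swap_apply_def]; split_ifs
      exacts [hv, hu, hx.1]
    · intro x _ y _ h; simpa using h
    · intro x hx
      simp only [mem_filter] at hx
      refine ⟨Equiv.swap u v x, ?_, by simp⟩
      simp only [mem_filter]
      refine ⟨?_, by simpa [Equiv.equivCongr] using hx.2⟩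
      rw [Equiv.swap_apply_def]; split_ifs
      exacts [hv, hu, hx.1]
  calc (#A : ℝ) * ∑ τ : V ≃ Fin (Fintype.card V), φ #{x ∈ A | τ v ≤ τ x}
      = ∑ u ∈ A, ∑ τ : V ≃ Fin (Fintype.card V), φ #{x ∈ A | τ u ≤ τ x} := by
        rw [sum_congr rfl hsymm, sum_const, nsmul_eq_mul]
    _ = ∑ τ : V ≃ Fin (Fintype.card V), ∑ j ∈ range #A, φ (j + 1) := by
        rw [sum_comm]
        exact sum_congr rfl fun τ _ => sum_rank τ τ.injective φ A
    _ = _ := by rw [sum_const, nsmul_eq_mul, card_univ]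

lemma sum_log_numAvail (D : V → Finset V) (d : ℕ) (hd : 0 < d) (hD : ∀ v, #(D v) = d)
    (σ : Equiv.Perm V) (hσ : ∀ v, σ v ∈ D v) (v : V) :
    ∑ τ : V ≃ Fin (Fintype.card V), Real.log (numAvail D τ σ v + 1) =
      Fintype.card (V ≃ Fin (Fintype.card V)) * (Real.log (d + 1).factorial / d) := by
  have h1 := card_mul_sum_rank (fun k => Real.log (k + 1)) ((D v).map σ.symm.toEmbedding) v
    (mem_map.2 ⟨σ v, hσ v, by simp⟩)
  have h2 : ∀ τ : V ≃ Fin (Fintype.card V),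
      #{x ∈ (D v).map σ.symm.toEmbedding | τ v ≤ τ x} = numAvail D τ σ v := by
    intro τ
    rw [filter_map, card_map]
    rfl
  have h3 : ∀ k : ℕ, ∑ j ∈ range k, Real.log (((j + 1 : ℕ) : ℝ) + 1) =
      Real.log (k + 1).factorial := by
    intro k
    induction k with
    | zero => simp
    | succ k ih =>
      rw [sum_range_succ, ih, Nat.factorial_succ (k + 1), Nat.cast_mul,
        Real.log_mul (by positivity) (by positivity), add_comm]
      push_cast
      rfl
  simp only [h2, card_map, hD, h3] at h1
  have : (d : ℝ) ≠ 0 := by positivity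
  field_simp
  linarith

/-- A weighted Brègman inequality. -/
lemma sum_two_pow_numOrbits_le (D : V → Finset V) (d : ℕ) (hd : 0 < d)
    (hD : ∀ v, #(D v) = d) :
    ∑ σ : Equiv.Perm V with ∀ v, σ v ∈ D v, (2 : ℝ) ^ numOrbits σ ≤
      Real.exp (Fintype.card V * (Real.log (d + 1).factorial / d)) := by
  set T := V ≃ Fin (Fintype.card V)
  set M : ℝ := (Fintype.card T : ℝ) with hM
  set K : ℝ := (Fintype.card V : ℝ) * (Real.log (d + 1).factorial / d) with hK
  have hT : Nonempty T := ⟨Fintype.equivFin V⟩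
  have hM0 : 0 < M := by rw [hM]; exact_mod_cast Fintype.card_pos
  have key : ∀ σ : Equiv.Perm V, (∀ v, σ v ∈ D v) →
      (2 : ℝ) ^ numOrbits σ * Real.exp (-K) ≤
        ∑ τ : T, M⁻¹ * ∏ v, stepWeight D τ σ v := by
    intro σ hσ
    have hlog : ∀ τ : T, numOrbits σ * Real.log 2 - ∑ v, Real.log (numAvail D τ σ v + 1) ≤
        Real.log (∏ v, stepWeight D τ σ v) := by
      intro τ
      rw [Real.log_prod (fun v _ => (stepWeight_pos D τ σ v).ne')]
      have : ∀ v, Real.log (stepWeight D τ σ v) =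
          (if IsLast τ σ v then Real.log 2 else 0) - Real.log (numAvail D τ σ v + 1) := by
        intro v
        unfold stepWeight
        rw [Real.log_div (by split_ifs <;> norm_num) (by positivity)]
        split_ifs <;> simp
      simp only [this, sum_sub_distrib]
      rw [← sum_filter, sum_const, nsmul_eq_mul]
      have h1 : (numOrbits σ : ℝ) ≤ #{v | IsLast τ σ v} := by
        exact_mod_cast numOrbits_le_card_isLast τ σ
      have h2 := mul_le_mul_of_nonneg_right h1 (Real.log_nonneg (by norm_num : (1 : ℝ) ≤ 2))
      linarith
    have hjensen := convexOn_exp.map_sum_le (t := (univ : Finset T)) (w := fun _ => M⁻¹)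
      (p := fun τ => Real.log (∏ v, stepWeight D τ σ v)) (fun _ _ => by positivity)
      (by rw [sum_const, card_univ, nsmul_eq_mul]; exact mul_inv_cancel₀ hM0.ne')
      (fun _ _ => Set.mem_univ _)
    simp only [smul_eq_mul] at hjensen
    have hexp : ∀ τ : T, Real.exp (Real.log (∏ v, stepWeight D τ σ v)) =
        ∏ v, stepWeight D τ σ v :=
      fun τ => Real.exp_log (prod_pos fun v _ => stepWeight_pos D τ σ v)
    simp only [hexp] at hjensen
    refine le_trans ?_ hjensen
    have h2 : (2 : ℝ) ^ numOrbits σ = Real.exp (numOrbits σ * Real.log 2) := by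
      rw [mul_comm, Real.exp_mul, Real.exp_log (by norm_num), Real.rpow_natCast]
    rw [h2, ← Real.exp_add]
    apply Real.exp_le_exp.2
    calc (numOrbits σ : ℝ) * Real.log 2 + -K
        = ∑ τ : T, M⁻¹ * (numOrbits σ * Real.log 2 -
            ∑ v, Real.log (numAvail D τ σ v + 1)) := by
          have hs : ∑ τ : T, ∑ v, Real.log (numAvail D τ σ v + 1) = M * K := by
            rw [sum_comm, sum_congr rfl fun v _ => sum_log_numAvail D d hd hD σ hσ v, sum_const,
              card_univ, nsmul_eq_mul, hK]
            ring
          rw [← mul_sum, sum_sub_distrib, hs, sum_const, card_univ, nsmul_eq_mul, ← hM]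
          field_simp
          ring
      _ ≤ _ := sum_le_sum fun τ _ => mul_le_mul_of_nonneg_left (hlog τ) (by positivity)
  have hsum : ∑ σ : Equiv.Perm V with ∀ v, σ v ∈ D v, (2 : ℝ) ^ numOrbits σ * Real.exp (-K) ≤
      1 := by
    calc _ ≤ ∑ σ : Equiv.Perm V with ∀ v, σ v ∈ D v,
          ∑ τ : T, M⁻¹ * ∏ v, stepWeight D τ σ v :=
          sum_le_sum fun σ hσ => key σ (by simpa using hσ)
      _ = ∑ τ : T, M⁻¹ * ∑ σ : Equiv.Perm V with ∀ v, σ v ∈ D v, ∏ v, stepWeight D τ σ v := by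
          rw [sum_comm]; simp only [mul_sum]
      _ ≤ ∑ τ : T, M⁻¹ * 1 := sum_le_sum fun τ _ =>
          mul_le_mul_of_nonneg_left (sum_prod_stepWeight_le_one D τ) (by positivity)
      _ = 1 := by
          rw [mul_one, sum_const, card_univ, nsmul_eq_mul]
          exact mul_inv_cancel₀ hM0.ne'
  rw [← sum_mul, Real.exp_neg, ← div_eq_mul_inv, div_le_one (Real.exp_pos _)] at hsum
  exact hsum

end Bregman

section Factorization

variable {V : Type*}

/-- The permutations `f i` decompose the digraph `D`. -/
def IsFactorization (D : V → Finset V) {d : ℕ} (f : Fin d → Equiv.Perm V) : Prop :=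
  ∀ v w, w ∈ D v ↔ ∃ i, f i v = w

lemma IsFactorization.append {D : V → Finset V} {D₁ D₂ : V → Finset V} {a b : ℕ}
    (hD : ∀ v w, w ∈ D v ↔ w ∈ D₁ v ∨ w ∈ D₂ v)
    {f₁ : Fin a → Equiv.Perm V} {f₂ : Fin b → Equiv.Perm V} (h₁ : IsFactorization D₁ f₁)
    (h₂ : IsFactorization D₂ f₂) : IsFactorization D (Fin.append f₁ f₂) := by
  intro v w
  rw [hD, h₁, h₂]
  constructor
  · rintro (⟨i, hi⟩ | ⟨i, hi⟩)
    · exact ⟨Fin.castAdd b i, by rw [Fin.append_left, hi]⟩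
    · exact ⟨Fin.natAdd a i, by rw [Fin.append_right, hi]⟩
  · rintro ⟨i, hi⟩
    induction i using Fin.addCases with
    | left i => exact Or.inl ⟨i, by rwa [Fin.append_left] at hi⟩
    | right i => exact Or.inr ⟨i, by rwa [Fin.append_right] at hi⟩

/-- The arcs of a digraph. -/
abbrev Arc (D : V → Finset V) : Type _ := {e : V × V // e.2 ∈ D e.1}

/-- Incidence of an arc with one of the two copies of the vertex set. -/
def ArcInc (D : V → Finset V) : V ⊕ V → Arc D → Prop :=
  Sum.elim (fun v e => e.1.1 = v) (fun w e => e.1.2 = w)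

lemma card_arc_fst (D : V → Finset V) (v : V) :
    Nat.card {e : Arc D // e.1.1 = v} = #(D v) := by
  rw [← Fintype.card_coe, ← Nat.card_eq_fintype_card]
  refine Nat.card_congr
    { toFun := fun x => ⟨x.1.1.2, ?_⟩
      invFun := fun w => ⟨⟨(v, w.1), w.2⟩, rfl⟩
      left_inv := ?_
      right_inv := fun _ => rfl }
  · obtain ⟨⟨⟨a, b⟩, hab⟩, rfl⟩ := x
    exact hab
  · rintro ⟨⟨⟨a, b⟩, hab⟩, rfl⟩
    rfl

variable [DecidableEq V]

lemma IsFactorization.injective {D : V → Finset V} {d : ℕ} {f : Fin d → Equiv.Perm V}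
    (hf : IsFactorization D f) (hD : ∀ v, #(D v) = d) (v : V) :
    Function.Injective (fun i => f i v) := by
  have h1 : univ.image (fun i => f i v) = D v := by
    ext w; simp [hf v w]
  have h2 : #(univ.image (fun i => f i v)) = #(univ : Finset (Fin d)) := by
    rw [h1, hD]; simp
  exact Set.injOn_univ.1 (by simpa using card_image_iff.1 h2)

/-- The arcs of colour `t`. -/
noncomputable def colorClass (D : V → Finset V) (c : Arc D → Bool) (t : Bool) (v : V) : Finset V :=
  {w ∈ D v | ∃ h : w ∈ D v, c ⟨(v, w), h⟩ = t}

lemma mem_colorClass {D : V → Finset V} {c : Arc D → Bool} {t : Bool} {v w : V} :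
    w ∈ colorClass D c t v ↔ ∃ h : w ∈ D v, c ⟨(v, w), h⟩ = t := by
  simp only [colorClass, mem_filter, and_iff_right_iff_imp]
  exact fun h => h.1

lemma card_colorClass (D : V → Finset V) (c : Arc D → Bool) (t : Bool) (v : V) :
    Nat.card {x : {e : Arc D // e.1.1 = v} // c x.1 = t} = #(colorClass D c t v) := by
  rw [← Fintype.card_coe, ← Nat.card_eq_fintype_card]
  refine Nat.card_congr
    { toFun := fun x => ⟨x.1.1.1.2, ?_⟩
      invFun := fun w => ⟨⟨⟨(v, w.1), (mem_colorClass.1 w.2).1⟩, rfl⟩, (mem_colorClass.1 w.2).2⟩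
      left_inv := ?_
      right_inv := fun _ => rfl }
  · obtain ⟨⟨⟨⟨a, b⟩, hab⟩, rfl⟩, hc⟩ := x
    exact mem_colorClass.2 ⟨hab, hc⟩
  · rintro ⟨⟨⟨⟨a, b⟩, hab⟩, rfl⟩, hc⟩
    rfl

variable [Fintype V]

/-- Every vertex of the digraph with out-neighbourhoods `D v` has out- and in-degree `d`. -/
structure IsBiregular (D : V → Finset V) (d : ℕ) : Prop where
  card_out : ∀ v, #(D v) = d
  card_in : ∀ w, #{v | w ∈ D v} = d

lemma card_le_card_balanced {D : V → Finset V} {h : ℕ} (hD : IsBiregular D (2 * h)) :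
    (2 * h).factorial ^ (2 * Fintype.card V) ≤
      #{c : Arc D → Bool | ∀ t, IsBiregular (colorClass D c t) h} *
        (2 ^ h * (h.factorial * h.factorial)) ^ (2 * Fintype.card V) := by
  have hin : ∀ (c : Arc D → Bool) (t : Bool) (w : V),
      Nat.card {x : {e : Arc D // e.1.2 = w} // c x.1 = t} = #{v | w ∈ colorClass D c t v} := by
    intro c t w
    rw [← Fintype.card_subtype, ← Nat.card_eq_fintype_card]
    refine Nat.card_congr
      { toFun := fun x => ⟨x.1.1.1.1, ?_⟩
        invFun := fun v => ⟨⟨⟨(v.1, w), (mem_colorClass.1 v.2).1⟩, rfl⟩, (mem_colorClass.1 v.2).2⟩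
        left_inv := ?_
        right_inv := fun _ => rfl }
    · obtain ⟨⟨⟨⟨a, b⟩, hab⟩, rfl⟩, hc⟩ := x
      exact mem_colorClass.2 ⟨hab, hc⟩
    · rintro ⟨⟨⟨⟨a, b⟩, hab⟩, rfl⟩, hc⟩
      rfl
  have hP : ∀ u, Nat.card {e // ArcInc D u e} = 2 * h := by
    rintro (v | w)
    · exact (card_arc_fst D v).trans (hD.card_out v)
    · rw [← hD.card_in w, ← Fintype.card_subtype, ← Nat.card_eq_fintype_card]
      refine Nat.card_congr (α := {e : Arc D // e.1.2 = w})
        { toFun := fun x => ⟨x.1.1.1, ?_⟩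
          invFun := fun v => ⟨⟨(v.1, w), v.2⟩, rfl⟩
          left_inv := ?_
          right_inv := fun _ => rfl }
      · obtain ⟨⟨⟨a, b⟩, hab⟩, rfl⟩ := x
        exact hab
      · rintro ⟨⟨⟨a, b⟩, hab⟩, rfl⟩
        rfl
  have key := pow_factorial_le_card_balanced (ArcInc D) h
    (fun u => by rw [← Nat.card_eq_fintype_card]; exact hP u) ?_
  · have hU : Fintype.card (V ⊕ V) = 2 * Fintype.card V := by
      rw [Fintype.card_sum, two_mul]
    rw [hU] at key
    refine key.trans (Nat.mul_le_mul_right _ ?_)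
    rw [Nat.card_eq_fintype_card, Fintype.card_subtype]
    apply card_le_card
    intro c hc
    simp only [mem_filter, mem_univ, true_and, ← Nat.card_eq_fintype_card] at hc ⊢
    intro t
    exact ⟨fun v => by rw [← card_colorClass]; exact hc (Sum.inl v) t,
      fun w => by rw [← hin]; exact hc (Sum.inr w) t⟩
  · intro L
    let L₁ : ∀ v, {e : Arc D // e.1.1 = v} ≃ Fin h × Bool := fun v => L (Sum.inl v)
    let L₂ : ∀ v, {e : Arc D // e.1.2 = v} ≃ Fin h × Bool := fun v => L (Sum.inr v)
    obtain ⟨c, hc⟩ := exists_alternating_coloring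
      (Function.Involutive.toPerm _ (partner_partner _ L₁))
      (Function.Involutive.toPerm _ (partner_partner _ L₂))
      (partner_partner _ L₁) (partner_partner _ L₂) (partner_ne _ L₁) (partner_ne _ L₂)
    refine ⟨c, ?_⟩
    rintro (v | v)
    · exact compatible_of_partner _ L₁ c (fun e => (hc e).1) v
    · exact compatible_of_partner _ L₂ c (fun e => (hc e).2) v

lemma card_factorization_ge_of_balanced {D : V → Finset V} {h : ℕ} :
    ∑ c : Arc D → Bool with ∀ t, IsBiregular (colorClass D c t) h,
      #{f : Fin h → Equiv.Perm V | IsFactorization (colorClass D c true) f} *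
        #{f : Fin h → Equiv.Perm V | IsFactorization (colorClass D c false) f} ≤
      #{f : Fin (h + h) → Equiv.Perm V | IsFactorization D f} := by
  simp only [← card_product]
  rw [← card_sigma]
  apply card_le_card_of_injOn (fun x => Fin.append x.2.1 x.2.2)
  · rintro ⟨c, f₁, f₂⟩ hx
    simp only [coe_sigma, Set.mem_sigma_iff, mem_coe, mem_filter, mem_univ, true_and,
      mem_product] at hx ⊢
    refine hx.2.1.append (fun v w => ?_) hx.2.2
    simp only [mem_colorClass]
    constructor
    · intro hw
      cases hc : c ⟨(v, w), hw⟩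
      · exact Or.inr ⟨hw, hc⟩
      · exact Or.inl ⟨hw, hc⟩
    · rintro (⟨hw, -⟩ | ⟨hw, -⟩) <;> exact hw
  · rintro ⟨c, f₁, f₂⟩ hx ⟨c', f₁', f₂'⟩ hx' heq
    simp only [coe_sigma, Set.mem_sigma_iff, mem_coe, mem_filter, mem_univ, true_and,
      mem_product] at hx hx' heq
    have h₁ : f₁ = f₁' := by
      funext i
      have := congrFun heq (Fin.castAdd h i)
      rwa [Fin.append_left, Fin.append_left] at this
    have h₂ : f₂ = f₂' := by
      funext i
      have := congrFun heq (Fin.natAdd h i)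
      rwa [Fin.append_right, Fin.append_right] at this
    subst h₁ h₂
    have hc : c = c' := by
      funext e
      have h3 := (hx.2.1 e.1.1 e.1.2).trans (hx'.2.1 e.1.1 e.1.2).symm
      simp only [mem_colorClass] at h3
      have he : e.1.2 ∈ D e.1.1 := e.2
      rw [Bool.eq_iff_iff]
      exact ⟨fun h => (h3.1 ⟨he, h⟩).2, fun h => (h3.2 ⟨he, h⟩).2⟩
    rw [hc]

/-- The number of `1`-factorizations of a regular bipartite graph whose degree is a power of
two. -/
lemma factorial_le_card_factorization (m : ℕ) : ∀ D : V → Finset V, IsBiregular D (2 ^ m) →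
    ((2 ^ m).factorial ^ 2) ^ Fintype.card V ≤
      #{f : Fin (2 ^ m) → Equiv.Perm V | IsFactorization D f} *
        ((2 ^ m) ^ (2 ^ m)) ^ Fintype.card V := by
  induction m with
  | zero =>
    intro D hD
    have h1 : ∀ v, ∃ w, D v = {w} := fun v => card_eq_one.1 (hD.card_out v)
    choose s hs using h1
    have hinj : Function.Injective s := by
      intro v v' hv
      have := (card_eq_one.1 (hD.card_in (s v)))
      obtain ⟨x, hx⟩ := this
      have h2 : v ∈ ({x} : Finset V) := by rw [← hx]; simp [hs]
      have h3 : v' ∈ ({x} : Finset V) := by rw [← hx]; simp [hs, hv]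
      rw [mem_singleton] at h2 h3
      rw [h2, h3]
    have hmem : (fun _ => Equiv.ofBijective s (Finite.injective_iff_bijective.1 hinj)) ∈
        ({f : Fin (2 ^ 0) → Equiv.Perm V | IsFactorization D f} : Finset _) := by
      rw [mem_filter]
      refine ⟨mem_univ _, fun v w => ?_⟩
      rw [hs, mem_singleton]
      exact ⟨fun h => ⟨⟨0, by norm_num⟩, h.symm⟩, fun ⟨_, h⟩ => h.symm⟩
    simpa using card_pos.2 ⟨_, hmem⟩
  | succ m ih =>
    intro D hD
    set h := 2 ^ m with hh
    have h2 : 2 ^ (m + 1) = h + h := by rw [pow_succ, mul_two]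
    have h2' : 2 ^ (m + 1) = 2 * h := by rw [pow_succ, mul_comm]
    rw [h2, ← two_mul]
    rw [h2'] at hD
    have hB := card_le_card_balanced hD
    have hL := card_factorization_ge_of_balanced (D := D) (h := h)
    set n := Fintype.card V
    set X : Finset (Arc D → Bool) := {c | ∀ t, IsBiregular (colorClass D c t) h}
    have hsum : #X * ((h.factorial ^ 2) ^ n * (h.factorial ^ 2) ^ n) ≤
        #{f : Fin (h + h) → Equiv.Perm V | IsFactorization D f} *
          ((h ^ h) ^ n * (h ^ h) ^ n) := by
      refine le_trans ?_ (Nat.mul_le_mul_right _ hL)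
      rw [sum_mul, ← smul_eq_mul]
      apply card_nsmul_le_sum
      intro c hc
      simp only [X, mem_filter, mem_univ, true_and] at hc
      have h3 := Nat.mul_le_mul (ih _ (hc true)) (ih _ (hc false))
      refine h3.trans (le_of_eq ?_)
      ring
    rw [← two_mul] at hsum
    calc ((2 * h).factorial ^ 2) ^ n = (2 * h).factorial ^ (2 * n) := by rw [pow_mul]
      _ ≤ #X * (2 ^ h * (h.factorial * h.factorial)) ^ (2 * n) := hB
      _ = #X * ((h.factorial ^ 2) ^ n * (h.factorial ^ 2) ^ n) * (2 ^ h) ^ (2 * n) := by ring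
      _ ≤ _ := Nat.mul_le_mul_right _ hsum
      _ = _ := by ring

lemma sum_two_pow_sum_numOrbits_le (d : ℕ) : ∀ D : V → Finset V, (∀ v, #(D v) = d) →
    ∑ f : Fin d → Equiv.Perm V with IsFactorization D f, (2 : ℝ) ^ (∑ i, numOrbits (f i)) ≤
      Real.exp (Fintype.card V *
        ∑ j ∈ range d, Real.log (j + 2).factorial / ((j : ℝ) + 1)) := by
  induction d with
  | zero =>
    intro D hD
    refine (sum_le_sum_of_subset_of_nonneg (filter_subset _ _)
      fun _ _ _ => by positivity).trans ?_
    simp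
  | succ d ih =>
    intro D hD
    have herase : ∀ σ : Equiv.Perm V, (∀ v, σ v ∈ D v) →
        ∀ v, #((D v).erase (σ v)) = d := by
      intro σ hσ v
      rw [card_erase_of_mem (hσ v), hD]; rfl
    calc ∑ f : Fin (d + 1) → Equiv.Perm V with IsFactorization D f,
          (2 : ℝ) ^ (∑ i, numOrbits (f i))
        ≤ ∑ x ∈ ({σ : Equiv.Perm V | ∀ v, σ v ∈ D v} : Finset _).sigma (fun σ =>
            ({g : Fin d → Equiv.Perm V | IsFactorization (fun v => (D v).erase (σ v)) g} :
              Finset _)), (2 : ℝ) ^ numOrbits x.1 * 2 ^ (∑ i, numOrbits (x.2 i)) := by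
          have hinj : Set.InjOn (fun f : Fin (d + 1) → Equiv.Perm V =>
              (⟨f 0, fun i => f i.succ⟩ : Σ _ : Equiv.Perm V, Fin d → Equiv.Perm V))
              ({f : Fin (d + 1) → Equiv.Perm V | IsFactorization D f} : Finset _) := by
            intro f _ g _ hfg
            simp only [Sigma.mk.injEq, heq_eq_eq] at hfg
            funext i
            induction i using Fin.cases with
            | zero => exact hfg.1
            | succ i => exact congrFun hfg.2 i
          refine le_trans (le_of_eq ?_) (sum_le_sum_of_subset_of_nonneg
            (s := image (fun f : Fin (d + 1) → Equiv.Perm V =>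
              (⟨f 0, fun i => f i.succ⟩ : Σ _ : Equiv.Perm V, Fin d → Equiv.Perm V))
              ({f : Fin (d + 1) → Equiv.Perm V | IsFactorization D f} : Finset _)) ?_
            fun _ _ _ => by positivity)
          · rw [sum_image hinj]
            simp only [Fin.sum_univ_succ, pow_add]
          · intro x hx
            obtain ⟨f, hf, rfl⟩ := mem_image.1 hx
            simp only [mem_filter, mem_univ, true_and] at hf
            simp only [mem_sigma, mem_filter, mem_univ, true_and]
            refine ⟨fun v => (hf v _).2 ⟨0, rfl⟩, fun v w => ?_⟩
            rw [mem_erase, hf v w, Fin.exists_fin_succ]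
            constructor
            · rintro ⟨hne, h | h⟩
              · exact absurd h.symm hne
              · exact h
            · rintro ⟨i, rfl⟩
              exact ⟨fun h => Fin.succ_ne_zero i (hf.injective hD v h), Or.inr ⟨i, rfl⟩⟩
      _ = ∑ σ : Equiv.Perm V with ∀ v, σ v ∈ D v, (2 : ℝ) ^ numOrbits σ *
            ∑ g : Fin d → Equiv.Perm V with IsFactorization (fun v => (D v).erase (σ v)) g,
              (2 : ℝ) ^ (∑ i, numOrbits (g i)) := by
          rw [sum_sigma]; simp only [mul_sum]
      _ ≤ ∑ σ : Equiv.Perm V with ∀ v, σ v ∈ D v, (2 : ℝ) ^ numOrbits σ *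
            Real.exp (Fintype.card V *
              ∑ j ∈ range d, Real.log (j + 2).factorial / ((j : ℝ) + 1)) := by
          apply sum_le_sum
          intro σ hσ
          simp only [mem_filter, mem_univ, true_and] at hσ
          exact mul_le_mul_of_nonneg_left (ih _ (herase σ hσ)) (by positivity)
      _ ≤ Real.exp (Fintype.card V * (Real.log (d + 1 + 1).factorial / ((d + 1 : ℕ) : ℝ))) *
            Real.exp (Fintype.card V *
              ∑ j ∈ range d, Real.log (j + 2).factorial / ((j : ℝ) + 1)) := by
          rw [← sum_mul]
          exact mul_le_mul_of_nonneg_right (sum_two_pow_numOrbits_le D (d + 1) d.succ_pos hD)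
            (Real.exp_pos _).le
      _ = _ := by
          rw [← Real.exp_add, sum_range_succ, mul_add, add_comm]
          push_cast
          rfl

end Factorization

section LogFactorial

lemma log_add_one_le {x : ℝ} (hx : 0 < x) : Real.log (x + 1) ≤ Real.log x + 1 / x := by
  have h := Real.log_le_sub_one_of_pos (x := (x + 1) / x) (by positivity)
  rw [Real.log_div (by positivity) hx.ne', add_div, div_self hx.ne'] at h
  linarith

lemma log_add_one_div_le_log_add_one {x : ℝ} (hx : 0 < x) :
    Real.log x + 1 / (x + 1) ≤ Real.log (x + 1) := by
  have h := Real.log_le_sub_one_of_pos (x := x / (x + 1)) (by positivity)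
  rw [Real.log_div hx.ne' (by positivity)] at h
  have : x / (x + 1) = 1 - 1 / (x + 1) := by field_simp; ring
  linarith

lemma log_factorial_le {k : ℕ} (hk : 1 ≤ k) :
    Real.log k.factorial ≤ (k + 1) * Real.log k - k + 1 := by
  induction k, hk using Nat.le_induction with
  | base => simp
  | succ k hk ih =>
    have hk' : (0 : ℝ) < k := by exact_mod_cast hk
    rw [Nat.factorial_succ, Nat.cast_mul, Real.log_mul (by positivity) (by positivity)]
    push_cast
    have h := log_add_one_div_le_log_add_one hk'
    have h' : ((k : ℝ) + 1) * (1 / (k + 1)) = 1 := by field_simp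
    nlinarith

lemma le_log_factorial {k : ℕ} (hk : 1 ≤ k) :
    k * Real.log k - k + 1 ≤ Real.log k.factorial := by
  induction k, hk using Nat.le_induction with
  | base => simp
  | succ k hk ih =>
    have hk' : (0 : ℝ) < k := by exact_mod_cast hk
    rw [Nat.factorial_succ, Nat.cast_mul, Real.log_mul (by positivity) (by positivity)]
    push_cast
    have h := log_add_one_le hk'
    have h' : (k : ℝ) * (1 / k) = 1 := by field_simp
    nlinarith

lemma log_factorial_eq_sum (d : ℕ) :
    Real.log d.factorial = ∑ j ∈ range d, Real.log ((j : ℝ) + 1) := by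
  induction d with
  | zero => simp
  | succ d ih =>
    rw [Nat.factorial_succ, Nat.cast_mul, Real.log_mul (by positivity) (by positivity),
      sum_range_succ, ih, add_comm]
    push_cast
    rfl

lemma sum_log_factorial_div_le {d : ℕ} (hd : 1 ≤ d) :
    ∑ j ∈ range d, Real.log (j + 2).factorial / ((j : ℝ) + 1) - 2 * Real.log d.factorial +
      d * Real.log d ≤ 2 + 5 * Real.log d + 2 * Real.log d ^ 2 := by
  have hd' : (1 : ℝ) ≤ d := by exact_mod_cast hd
  have hL : 0 ≤ Real.log d := Real.log_nonneg hd'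
  have hH : ∑ j ∈ range d, 1 / ((j : ℝ) + 1) ≤ 1 + Real.log d := by
    have := harmonic_le_one_add_log d
    simpa [harmonic] using this
  have hterm : ∀ j ∈ range d, Real.log (j + 2).factorial / ((j : ℝ) + 1) ≤
      Real.log ((j : ℝ) + 1) + (3 + 2 * Real.log d) * (1 / ((j : ℝ) + 1)) - 1 := by
    intro j hj
    have hj0 : (0 : ℝ) < (j : ℝ) + 1 := by positivity
    have hjd : (j : ℝ) + 1 ≤ d := by exact_mod_cast mem_range.1 hj
    have h1 := log_factorial_le (k := j + 2) (by omega)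
    have h2 := log_add_one_le hj0
    have h3 : Real.log ((j : ℝ) + 1) ≤ Real.log d := Real.log_le_log hj0 hjd
    have h4 : 1 / ((j : ℝ) + 1) ≤ 1 := by
      rw [div_le_one hj0]; linarith [(Nat.cast_nonneg j : (0 : ℝ) ≤ j)]
    have h5 : ((j : ℝ) + 1) * (1 / ((j : ℝ) + 1)) = 1 := by field_simp
    rw [div_le_iff₀ hj0]
    push_cast at h1
    have h6 : (j : ℝ) + 2 = j + 1 + 1 := by ring
    rw [h6] at h1
    set x : ℝ := (j : ℝ) + 1
    set y : ℝ := 1 / x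
    have h7 : (Real.log x + (3 + 2 * Real.log d) * y - 1) * x =
      x * Real.log x + (3 + 2 * Real.log d) * (x * y) - x := by ring
    rw [h7, h5]
    nlinarith [mul_le_mul_of_nonneg_left h2 hj0.le]
  have hsum := sum_le_sum hterm
  rw [sum_sub_distrib, sum_add_distrib, ← mul_sum, ← log_factorial_eq_sum] at hsum
  simp only [sum_const, card_range, nsmul_eq_mul, mul_one] at hsum
  have h8 := le_log_factorial hd
  nlinarith [mul_le_mul_of_nonneg_left hH (by positivity : 0 ≤ 3 + 2 * Real.log d)]

end LogFactorial

section Regular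

variable {V : Type*} [Fintype V] [DecidableEq V]

lemma exists_factorization_two_pow {m : ℕ} {D : V → Finset V} (hD : IsBiregular D (2 ^ m)) :
    ∃ f : Fin (2 ^ m) → Equiv.Perm V, IsFactorization D f ∧
      (∑ i, (numOrbits (f i) : ℝ)) ≤ 3 * Fintype.card V * (1 + (m : ℝ)) ^ 2 := by
  set n := Fintype.card V
  set S : Finset (Fin (2 ^ m) → Equiv.Perm V) := {f | IsFactorization D f}
  have hcount := factorial_le_card_factorization m D hD
  have hsum := sum_two_pow_sum_numOrbits_le (2 ^ m) D hD.card_out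
  set A : ℝ := ∑ j ∈ range (2 ^ m), Real.log (j + 2).factorial / ((j : ℝ) + 1)
  have hne : S.Nonempty := by
    rw [← card_pos]
    refine Nat.pos_of_ne_zero fun h => ?_
    rw [h, zero_mul, Nat.le_zero] at hcount
    exact absurd hcount (by positivity)
  obtain ⟨f, hf, hmin⟩ := exists_min_image S (fun f => ∑ i, numOrbits (f i)) hne
  refine ⟨f, (mem_filter.1 hf).2, ?_⟩
  set K := ∑ i, numOrbits (f i)
  have h1 : (2 : ℝ) ^ K * #S ≤ Real.exp (n * A) := by
    refine le_trans ?_ hsum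
    rw [mul_comm, ← nsmul_eq_mul]
    exact card_nsmul_le_sum _ _ _ fun g hg => pow_le_pow_right₀ (by norm_num) (hmin g hg)
  have hcount' : ((((2 ^ m).factorial : ℕ) : ℝ) ^ 2) ^ n ≤
      #S * (((2 : ℝ) ^ m) ^ (2 ^ m)) ^ n := by exact_mod_cast hcount
  have h2 : (2 : ℝ) ^ K * ((((2 ^ m).factorial : ℕ) : ℝ) ^ 2) ^ n ≤
      Real.exp (n * A) * (((2 : ℝ) ^ m) ^ (2 ^ m)) ^ n :=
    calc _ ≤ (2 : ℝ) ^ K * (#S * (((2 : ℝ) ^ m) ^ (2 ^ m)) ^ n) :=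
          mul_le_mul_of_nonneg_left hcount' (by positivity)
      _ = (2 : ℝ) ^ K * #S * (((2 : ℝ) ^ m) ^ (2 ^ m)) ^ n := by ring
      _ ≤ _ := mul_le_mul_of_nonneg_right h1 (by positivity)
  have h3 := Real.log_le_log (by positivity) h2
  rw [Real.log_mul (by positivity) (by positivity), Real.log_mul (by positivity) (by positivity),
    Real.log_exp] at h3
  simp only [Real.log_pow] at h3
  have h4 := sum_log_factorial_div_le (Nat.one_le_two_pow (n := m))
  push_cast at h3 h4
  rw [Real.log_pow] at h4
  have hl := Real.log_two_gt_d9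
  have hu := Real.log_two_lt_d9
  set l := Real.log 2
  have hm : (0 : ℝ) ≤ m := by positivity
  have h5 : A - 2 * Real.log ((2 ^ m).factorial) + 2 ^ m * (m * l) ≤
      l * (3 * (1 + (m : ℝ)) ^ 2) := by
    refine h4.trans ?_
    nlinarith [mul_nonneg hm (by linarith : 0 ≤ l), mul_nonneg (sq_nonneg (m : ℝ))
      (by nlinarith : 0 ≤ 3 * l - 2 * l ^ 2)]
  have hn : (0 : ℝ) ≤ n := by positivity
  have h6 := mul_le_mul_of_nonneg_left h5 hn
  rw [← Nat.cast_sum]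
  refine le_of_mul_le_mul_left (a := l) ?_ (by linarith)
  linarith

lemma IsBiregular.exists_perm {d : ℕ} {D : V → Finset V} (hD : IsBiregular D d) (hd : 0 < d) :
    ∃ σ : Equiv.Perm V, ∀ v, σ v ∈ D v := by
  obtain ⟨s, hs, hsD⟩ := (all_card_le_biUnion_card_iff_exists_injective D).1 fun A => by
    refine Nat.le_of_mul_le_mul_right (card_mul_le_card_mul (fun v w => w ∈ D v)
      (fun v hv => ?_) fun w _ => ?_) hd
    · rw [← hD.card_out v]
      exact card_le_card fun w hw => mem_filter.2 ⟨mem_biUnion.2 ⟨v, hv, hw⟩, hw⟩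
    · rw [← hD.card_in w]
      exact card_le_card fun v hv => mem_filter.2 ⟨mem_univ _, (mem_filter.1 hv).2⟩
  exact ⟨Equiv.ofBijective s (Finite.injective_iff_bijective.1 hs), hsD⟩

lemma IsBiregular.erase {d : ℕ} {D : V → Finset V} (hD : IsBiregular D (d + 1))
    {σ : Equiv.Perm V} (hσ : ∀ v, σ v ∈ D v) :
    IsBiregular (fun v => (D v).erase (σ v)) d where
  card_out v := by rw [card_erase_of_mem (hσ v), hD.card_out]; rfl
  card_in w := by
    have : ({v | w ∈ (D v).erase (σ v)} : Finset V) =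
        ({v | w ∈ D v} : Finset V).erase (σ.symm w) := by
      ext v
      simp only [mem_erase, mem_filter, mem_univ, true_and, Ne, Equiv.eq_symm_apply,
        eq_comm (a := w)]
    rw [this, card_erase_of_mem, hD.card_in]
    · rfl
    · simpa using hσ (σ.symm w)

lemma IsBiregular.insert {d : ℕ} {D : V → Finset V} (hD : IsBiregular D d)
    {σ : Equiv.Perm V} (hσ : ∀ v, σ v ∉ D v) :
    IsBiregular (fun v => insert (σ v) (D v)) (d + 1) where
  card_out v := by rw [card_insert_of_notMem (hσ v), hD.card_out]
  card_in w := by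
    have : ({v | w ∈ Insert.insert (σ v) (D v)} : Finset V) =
        Insert.insert (σ.symm w) ({v | w ∈ D v} : Finset V) := by
      ext v
      simp only [mem_insert, mem_filter, mem_univ, true_and, Equiv.eq_symm_apply,
        eq_comm (a := w)]
    rw [this, card_insert_of_notMem, hD.card_in]
    simpa using hσ (σ.symm w)

lemma IsBiregular.exists_split (k b : ℕ) : ∀ D : V → Finset V, IsBiregular D (k + b) →
    ∃ D₁ D₂ : V → Finset V, IsBiregular D₁ k ∧ IsBiregular D₂ b ∧
      ∀ v w, w ∈ D v ↔ w ∈ D₁ v ∨ w ∈ D₂ v := by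
  induction k with
  | zero =>
    intro D hD
    rw [zero_add] at hD
    exact ⟨fun _ => ∅, D, ⟨fun _ => rfl, fun _ => by simp⟩, hD, fun v w => by simp⟩
  | succ k ih =>
    intro D hD
    obtain ⟨σ, hσ⟩ := hD.exists_perm (by omega)
    rw [Nat.add_right_comm] at hD
    obtain ⟨D₁, D₂, h₁, h₂, h⟩ := ih _ (hD.erase hσ)
    refine ⟨fun v => Insert.insert (σ v) (D₁ v), D₂, h₁.insert fun v hv => ?_, h₂, fun v w => ?_⟩
    · simpa using (h v _).2 (Or.inl hv)
    · rw [mem_insert, or_assoc, ← h, mem_erase]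
      by_cases hw : w = σ v
      · simp [hw, hσ v]
      · simp [hw]

lemma exists_factorization (m : ℕ) : ∀ (d : ℕ) (D : V → Finset V), d < 2 ^ m → IsBiregular D d →
    ∃ f : Fin d → Equiv.Perm V, IsFactorization D f ∧
      (∑ i, (numOrbits (f i) : ℝ)) ≤ 3 * Fintype.card V * (m : ℝ) ^ 3 := by
  induction m with
  | zero =>
    intro d D hd hD
    obtain rfl : d = 0 := by simpa using hd
    refine ⟨Fin.elim0, fun v w => ?_, by simp⟩
    rw [card_eq_zero.1 (hD.card_out v)]
    simp
  | succ m ih =>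
    intro d D hd hD
    have hn : (0 : ℝ) ≤ Fintype.card V := by positivity
    have hm : (0 : ℝ) ≤ m := by positivity
    rcases lt_or_ge d (2 ^ m) with hlt | hge
    · obtain ⟨f, hf, hle⟩ := ih d D hlt hD
      refine ⟨f, hf, hle.trans ?_⟩
      push_cast
      gcongr
      linarith
    · obtain ⟨b, rfl⟩ := Nat.exists_eq_add_of_le hge
      obtain ⟨D₁, D₂, h₁, h₂, h⟩ := IsBiregular.exists_split _ _ D hD
      obtain ⟨f₁, hf₁, hle₁⟩ := exists_factorization_two_pow h₁
      obtain ⟨f₂, hf₂, hle₂⟩ := ih b D₂ (by rw [pow_succ] at hd; omega) h₂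
      refine ⟨Fin.append f₁ f₂, hf₁.append h hf₂, ?_⟩
      rw [Fin.sum_univ_add]
      simp only [Fin.append_left, Fin.append_right]
      push_cast
      nlinarith [mul_nonneg hn hm, mul_nonneg hn (sq_nonneg (m : ℝ))]

end Regular

section TwoFactor

variable {V : Type}

/-- The graph joining every vertex to its image under `σ`. -/
def permGraph (σ : Equiv.Perm V) : SimpleGraph V := SimpleGraph.fromRel fun a b => σ a = b

lemma permGraph_adj {σ : Equiv.Perm V} {a b : V} :
    (permGraph σ).Adj a b ↔ a ≠ b ∧ (σ a = b ∨ σ b = a) := Iff.rfl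

lemma deg_permGraph {σ : Equiv.Perm V} (h₁ : ∀ v, σ v ≠ v) (h₂ : ∀ v, σ (σ v) ≠ v) (v : V) :
    deg (permGraph σ) v = 2 := by
  have : (permGraph σ).neighborSet v = {σ v, σ.symm v} := by
    ext w
    rw [SimpleGraph.mem_neighborSet, permGraph_adj, Set.mem_insert_iff, Set.mem_singleton_iff,
      Equiv.eq_symm_apply, eq_comm (a := w)]
    refine ⟨fun h => h.2, fun h => ⟨?_, h⟩⟩
    rintro rfl
    exact h₁ v (by tauto)
  rw [deg, this, Set.ncard_pair]
  rw [Ne, Equiv.eq_symm_apply]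
  exact h₂ v

lemma numCycles_permGraph_le [Finite V] (σ : Equiv.Perm V) :
    numCycles (permGraph σ) ≤ numOrbits σ := by
  have hpow : ∀ (v : V) (i : ℕ), (permGraph σ).Reachable v ((σ ^ i) v) := by
    intro v i
    induction i with
    | zero => exact SimpleGraph.Reachable.refl v
    | succ i ih =>
      refine ih.trans ?_
      rw [pow_succ', Equiv.Perm.mul_apply]
      by_cases he : (σ ^ i) v = σ ((σ ^ i) v)
      · rw [← he]
      · exact SimpleGraph.Adj.reachable (permGraph_adj.2 ⟨he, Or.inl rfl⟩)
  refine Nat.card_le_card_of_surjective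
    (Quotient.lift (s := Equiv.Perm.SameCycle.setoid σ) (permGraph σ).connectedComponentMk ?_) ?_
  · intro v w hvw
    obtain ⟨i, -, rfl⟩ := Equiv.Perm.SameCycle.exists_pow_eq' (f := σ) hvw
    exact SimpleGraph.ConnectedComponent.sound (hpow v i)
  · intro x
    induction x using SimpleGraph.ConnectedComponent.ind with
    | h v => exact ⟨Quotient.mk _ v, rfl⟩

variable [Fintype V] [DecidableEq V]

/-- A `2h`-regular graph has an orientation with all out- and in-degrees equal to `h`. -/
lemma exists_balanced_orientation (H : SimpleGraph V) {h : ℕ} (hH : ∀ v, deg H v = 2 * h) :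
    ∃ D : V → Finset V, IsBiregular D h ∧ (∀ v w, H.Adj v w ↔ w ∈ D v ∨ v ∈ D w) ∧
      ∀ v w, w ∈ D v → v ∉ D w := by
  let N : V → Finset V := fun v => {w | H.Adj v w}
  have hN : ∀ {v w}, w ∈ N v ↔ H.Adj v w := by simp [N]
  have hcard : ∀ v, #(N v) = 2 * h := by
    intro v
    rw [← hH v, deg, Set.ncard_eq_toFinset_card']
    congr 1
    ext w
    simp [hN]
  let L : ∀ v, {e : Arc N // e.1.1 = v} ≃ Fin h × Bool := fun v =>
    Fintype.equivOfCardEq (by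
      rw [← Nat.card_eq_fintype_card, card_arc_fst, hcard, Fintype.card_prod, Fintype.card_fin,
        Fintype.card_bool, mul_comm])
  let rev : Arc N → Arc N := fun e => ⟨e.1.swap, hN.2 (hN.1 e.2).symm⟩
  have hrev : Function.Involutive rev := fun e => rfl
  obtain ⟨c, hc⟩ := exists_alternating_coloring (Function.Involutive.toPerm _ (partner_partner _ L))
    hrev.toPerm (partner_partner _ L) hrev (partner_ne _ L) fun e he =>
      (hN.1 e.2).ne (congrArg (fun x : Arc N => x.1.1) he).symm
  have hclass : ∀ t v, #(colorClass N c t v) = h := by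
    intro t v
    rw [← card_colorClass, Nat.card_eq_fintype_card]
    exact (compatible_of_partner _ L c (fun e => (hc e).1) v).card_eq t
  have hswap : ∀ v w, w ∈ colorClass N c true v ↔ v ∈ colorClass N c false w := by
    intro v w
    simp only [mem_colorClass]
    constructor
    · rintro ⟨hw, hcw⟩
      have := (hc ⟨(v, w), hw⟩).2
      rw [hcw] at this
      exact ⟨hN.2 (hN.1 hw).symm, Bool.eq_false_of_not_eq_true this⟩
    · rintro ⟨hw, hcw⟩
      have := (hc ⟨(w, v), hw⟩).2
      rw [hcw] at this
      exact ⟨hN.2 (hN.1 hw).symm, Bool.eq_true_of_not_eq_false this⟩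
  refine ⟨colorClass N c true, ⟨hclass true, fun w => ?_⟩, fun v w => ?_, fun v w hw hv => ?_⟩
  · rw [← hclass false w]
    congr 1
    ext v
    simp [hswap]
  · rw [hswap w v, ← hN]
    simp only [mem_colorClass]
    constructor
    · intro hw
      cases hcw : c ⟨(v, w), hw⟩
      · exact Or.inr ⟨hw, hcw⟩
      · exact Or.inl ⟨hw, hcw⟩
    · rintro (⟨hw, -⟩ | ⟨hw, -⟩) <;> exact hw
  · rw [hswap] at hw
    obtain ⟨_, h1⟩ := mem_colorClass.1 hw
    obtain ⟨_, h2⟩ := mem_colorClass.1 hv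
    exact absurd (h1.symm.trans h2) (by simp)

lemma exists_twoFactorization (H : SimpleGraph V) {h m : ℕ} (hH : ∀ v, deg H v = 2 * h)
    (hm : h < 2 ^ m) :
    ∃ F : Fin h → SimpleGraph V,
      (∀ i, F i ≤ H ∧ ∀ v, deg (F i) v = 2) ∧
      (∀ i j, i ≠ j → Disjoint (F i).edgeSet (F j).edgeSet) ∧
      (⨆ i, F i) = H ∧
      (∑ i, (numCycles (F i) : ℝ)) ≤ 3 * Fintype.card V * (m : ℝ) ^ 3 := by
  obtain ⟨D, hD, hadj, hanti⟩ := exists_balanced_orientation H hH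
  obtain ⟨f, hf, hsum⟩ := exists_factorization m h D hm hD
  have hmem : ∀ i v, f i v ∈ D v := fun i v => (hf v _).2 ⟨i, rfl⟩
  have hle : ∀ i, permGraph (f i) ≤ H := by
    intro i a b hab
    rw [hadj]
    rcases hab.2 with rfl | rfl
    · exact Or.inl (hmem i a)
    · exact Or.inr (hmem i b)
  refine ⟨fun i => permGraph (f i), fun i => ⟨hle i, deg_permGraph (fun v hv => ?_)
    fun v hv => ?_⟩, fun i j hij => ?_, le_antisymm (iSup_le hle) fun a b hab => ?_, ?_⟩
  · have := hmem i v
    rw [hv] at this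
    exact hanti v v this this
  · have := hmem i (f i v)
    rw [hv] at this
    exact hanti _ _ (hmem i v) this
  · rw [SimpleGraph.disjoint_edgeSet, SimpleGraph.disjoint_left]
    rintro a b ⟨-, h1⟩ ⟨-, h2⟩
    have hforward : ∀ a b, f i a = b → f j a = b → False := fun a b h1 h2 =>
      hij (hf.injective hD.card_out a (h1.trans h2.symm))
    have hback : ∀ (i j : Fin h) (a b : V), f i a = b → f j b = a → False := by
      intro i j a b h1 h2
      exact hanti a b ((hf a b).2 ⟨i, h1⟩) ((hf b a).2 ⟨j, h2⟩)
    rcases h1 with h1 | h1 <;> rcases h2 with h2 | h2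
    · exact hforward _ _ h1 h2
    · exact hback _ _ _ _ h1 h2
    · exact hback _ _ _ _ h1 h2
    · exact hforward _ _ h1 h2
  · rw [SimpleGraph.iSup_adj]
    rcases (hadj a b).1 hab with hb | ha
    · obtain ⟨i, hi⟩ := (hf a b).1 hb
      exact ⟨i, hab.ne, Or.inl hi⟩
    · obtain ⟨i, hi⟩ := (hf b a).1 ha
      exact ⟨i, hab.ne, Or.inr hi⟩
  · refine le_trans (sum_le_sum fun i _ => ?_) hsum
    exact_mod_cast numCycles_permGraph_le (f i)

end TwoFactor

lemma pow_six_le_two_pow (m : ℕ) : m ^ 6 ≤ 1331 * 2 ^ m := by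
  rcases lt_or_ge m 9 with hm | hm
  · interval_cases m <;> norm_num
  · induction m, hm using Nat.le_induction with
    | base => norm_num
    | succ m hm ih =>
      have h1 : (9 * (m + 1)) ^ 6 ≤ (10 * m) ^ 6 := Nat.pow_le_pow_left (by omega) 6
      rw [mul_pow, mul_pow] at h1
      rw [pow_succ 2 m]
      omega

end EDHC

open EDHC in
/-- Corollary 6.5 (2FacSplit): decomposition into 2-factors with few cycles in total. -/
theorem stmt_14 :
    ∃ N : ℕ, ∀ n : ℕ, N ≤ n →
      ∀ (rG : ℝ) (G H : SimpleGraph (Fin n)) (rH : ℕ),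
      IsPseudorandom n G (rG / n) → (Real.log n) ^ 2 ≤ rG →
      H ≤ G → (∀ v, deg H v = rH) → Even rH →
      ∃ F : Fin (rH / 2) → SimpleGraph (Fin n),
        (∀ i, F i ≤ H ∧ ∀ v, deg (F i) v = 2) ∧
        (∀ i j, i ≠ j → Disjoint (F i).edgeSet (F j).edgeSet) ∧
        (⨆ i, F i) = H ∧
        (∑ i, (numCycles (F i) : ℝ)) ≤ 3 * (n : ℝ) * Real.sqrt (rG * (Real.log n) ^ 3) := by
  refine ⟨3 ^ 11, fun n hn rG G H rH hG hrG hHG hH heven => ?_⟩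
  obtain ⟨h, rfl⟩ := heven
  have hn0 : 0 < n := lt_of_lt_of_le (by norm_num) hn
  have hlog : 11 ≤ Real.log n := by
    have h1 : Real.log ((3 : ℝ) ^ 11) ≤ Real.log n :=
      Real.log_le_log (by norm_num) (by exact_mod_cast hn)
    have h2 : 1 ≤ Real.log 3 := by
      rw [Real.le_log_iff_exp_le (by norm_num)]
      linarith [Real.exp_one_lt_d9]
    rw [Real.log_pow] at h1
    push_cast at h1
    linarith
  have hr : ((h + h : ℕ) : ℝ) ≤ rG := by
    have : Nonempty (Fin n) := ⟨⟨0, hn0⟩⟩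
    obtain ⟨v, hv⟩ := Nat.sInf_mem (Set.range_nonempty (deg G))
    have hle : h + h ≤ minDeg G := by
      rw [minDeg, ← hv, ← hH v]
      exact Set.ncard_le_ncard fun w hw => hHG hw
    have hmin := hG.2.2.2.1.2.1
    rw [mul_div_cancel₀ _ (by positivity : (n : ℝ) ≠ 0)] at hmin
    have hle' : ((h + h : ℕ) : ℝ) ≤ minDeg G := by exact_mod_cast hle
    linarith [Real.sqrt_nonneg (rG * (1 - rG / n))]
  rw [show (h + h) / 2 = h by omega]
  obtain ⟨F, hF, hdisj, hsup, hsum⟩ := exists_twoFactorization H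
    (fun v => (hH v).trans (two_mul h).symm) (Nat.lt_size_self h)
  refine ⟨F, hF, hdisj, hsup, hsum.trans ?_⟩
  rw [Fintype.card_fin]
  refine mul_le_mul_of_nonneg_left (Real.le_sqrt_of_sq_le ?_) (by positivity)
  rcases Nat.eq_zero_or_pos h with rfl | hh
  · simp only [Nat.size_zero, Nat.cast_zero]
    rw [zero_pow three_ne_zero, zero_pow two_ne_zero]
    exact mul_nonneg ((sq_nonneg _).trans hrG) (by positivity)
  · obtain ⟨m, hm⟩ := Nat.exists_eq_succ_of_ne_zero (Nat.size_pos.2 hh).ne'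
    have h2 : 2 ^ m ≤ h := Nat.lt_size.1 (by omega)
    have h3 : (2 : ℝ) ^ (m + 1) ≤ rG := by
      refine le_trans ?_ hr
      rw [pow_succ, mul_two]
      push_cast
      have : (2 : ℝ) ^ m ≤ h := by exact_mod_cast h2
      linarith
    have h4 : (((m + 1 : ℕ) : ℝ)) ^ 6 ≤ 1331 * 2 ^ (m + 1) := by
      exact_mod_cast pow_six_le_two_pow (m + 1)
    have h5 : (11 : ℝ) ^ 3 ≤ Real.log n ^ 3 := by gcongr
    rw [hm, ← pow_mul]
    calc (((m.succ : ℕ) : ℝ)) ^ (3 * 2) ≤ 1331 * 2 ^ (m + 1) := h4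
      _ ≤ Real.log n ^ 3 * rG := mul_le_mul (by linarith) h3 (by positivity) (by positivity)
      _ = _ := mul_comm _ _
end

section
/- There exists N such that the following holds for all n ≥ N. Let G be an (r_G/n)-pseudorandom graph on n vertices with r_G ≥ (log n)², and let H be a spanning subgraph of G with δ(H) ≥ (549/550)·r_G + 5. Let M be a matching with V(M) ⊆ V(G) that is edge-disjoint from H. Then: (i) if n is even, M can be partitioned into submatchings M₁ and M₂ such that there exist disjoint edge sets E₁, E₂ ⊆ E(H) with M₁ ∪ E₁ and M₂ ∪ E₂ each a perfect matching on V(G); (ii) if n is odd, M can be partitioned into submatchings M₁ and M₂ such that there exist disjoint edge sets E₁, E₂ ⊆ E(H) with M₁ ∪ E₁ and M₂ ∪ E₂ each a perfect pseudomatching on V(G). -/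
open scoped Classical
open SimpleGraph

namespace EDHC

/-- A graph of even order has a perfect matching if its small vertex sets expand and any two large
disjoint vertex sets are joined by an edge. -/
lemma exists_isPerfectMatching_of_expansion {V : Type} [Fintype V] (K : SimpleGraph V)
    (heven : Even (Fintype.card V)) (t : ℝ) (ht : 0 < t)
    (hexp : ∀ X U : Finset V, Disjoint X U → X.Nonempty → U.card ≤ X.card →
      (∀ x ∈ X, ∀ y, K.Adj x y → y ∈ X ∨ y ∈ U) → 2 * t ≤ X.card)
    (hconn : ∀ Z₁ Z₂ : Finset V, Disjoint Z₁ Z₂ → t ≤ Z₁.card → t ≤ Z₂.card →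
      ∃ a ∈ Z₁, ∃ b ∈ Z₂, K.Adj a b) :
    ∃ P : K.Subgraph, P.IsPerfectMatching := by
  rw [SimpleGraph.tutte]
  intro U hU
  set D := ((⊤ : K.Subgraph).deleteVerts U).coe with hD
  have hverts : ∀ v, v ∈ ((⊤ : K.Subgraph).deleteVerts U).verts ↔ v ∉ U := by
    intro v; simp
  have : Fintype D.ConnectedComponent := Fintype.ofFinite _
  let S : Finset D.ConnectedComponent → Finset V := fun 𝒵 =>
    Finset.univ.filter fun v => ∃ h : v ∈ ((⊤ : K.Subgraph).deleteVerts U).verts,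
      D.connectedComponentMk ⟨v, h⟩ ∈ 𝒵
  have hSmem : ∀ 𝒵 v, v ∈ S 𝒵 ↔ ∃ h : v ∈ ((⊤ : K.Subgraph).deleteVerts U).verts,
      D.connectedComponentMk ⟨v, h⟩ ∈ 𝒵 := by
    intro 𝒵 v; simp [S]
  have hcard : ∀ 𝒵, 𝒵.card ≤ (S 𝒵).card := by
    intro 𝒵
    refine Finset.card_le_card_of_injOn (fun c => (c.out : V)) ?_ ?_
    · intro c hc
      rw [Finset.mem_coe, hSmem]
      refine ⟨c.out.2, ?_⟩
      have : D.connectedComponentMk c.out = c := Quot.out_eq c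
      simpa [this] using hc
    · intro c _ c' _ h
      have h' : c.out = c'.out := Subtype.ext h
      have h1 : D.connectedComponentMk c.out = c := Quot.out_eq c
      have h2 : D.connectedComponentMk c'.out = c' := Quot.out_eq c'
      rw [← h1, h', h2]
  have hclosed : ∀ 𝒵, ∀ x ∈ S 𝒵, ∀ y, K.Adj x y → y ∈ S 𝒵 ∨ y ∈ U.toFinset := by
    intro 𝒵 x hx y hxy
    by_cases hy : y ∈ U
    · right; simpa using hy
    · left
      obtain ⟨h, hc⟩ := (hSmem _ _).1 hx
      refine (hSmem _ _).2 ⟨(hverts y).2 hy, ?_⟩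
      have hadj : D.Adj ⟨x, h⟩ ⟨y, (hverts y).2 hy⟩ := by
        have := (hverts x).1 h
        simp [hD, hxy, this, hy]
      rwa [← SimpleGraph.ConnectedComponent.connectedComponentMk_eq_of_adj hadj]
  have hdisjU : ∀ 𝒵, Disjoint (S 𝒵) U.toFinset := by
    intro 𝒵
    rw [Finset.disjoint_left]
    intro x hx
    obtain ⟨h, -⟩ := (hSmem _ _).1 hx
    simpa using (hverts x).1 h
  have hUc : U.toFinset.card < Fintype.card D.ConnectedComponent := by
    have h1 : U.ncard < D.oddComponents.ncard := hU
    rw [Set.ncard_eq_toFinset_card'] at h1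
    refine h1.trans_le ?_
    rw [← Nat.card_eq_fintype_card]
    exact Set.ncard_le_card _
  have hU2 : 2 ≤ Fintype.card D.ConnectedComponent := by
    by_cases hU0 : U = ∅
    · have h1 : U.ncard < D.oddComponents.ncard := hU
      have h2 : ¬ Odd D.oddComponents.ncard := by
        rw [SimpleGraph.odd_ncard_oddComponents, Nat.not_odd_iff_even]
        have : Nat.card ((⊤ : K.Subgraph).deleteVerts U).verts = Fintype.card V := by
          rw [← Nat.card_eq_fintype_card]
          exact Nat.card_congr (Equiv.subtypeUnivEquiv (fun v => (hverts v).2 (by simp [hU0])))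
        rw [this]; exact heven
      rw [Nat.not_odd_iff_even] at h2
      have h3 : D.oddComponents.ncard ≤ Nat.card D.ConnectedComponent := Set.ncard_le_card _
      rw [Nat.card_eq_fintype_card] at h3
      rcases h2 with ⟨k, hk⟩
      omega
    · have : U.toFinset.Nonempty := by
        rw [Set.toFinset_nonempty]; exact Set.nonempty_iff_ne_empty.2 hU0
      have := this.card_pos
      omega
  have hbig : ∀ c : D.ConnectedComponent, 2 * t ≤ (S (Finset.univ.erase c)).card := by
    intro c
    have h1 := hcard (Finset.univ.erase c)
    rw [Finset.card_erase_of_mem (Finset.mem_univ c), Finset.card_univ] at h1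
    exact hexp _ _ (hdisjU _) (Finset.card_pos.1 (by omega)) (by omega) (hclosed _)
  obtain ⟨c₀⟩ : Nonempty D.ConnectedComponent := Fintype.card_pos_iff.1 (by omega)
  obtain ⟨𝒵, h𝒵, hmin⟩ := Finset.exists_min_image
    (Finset.univ.filter fun 𝒵 : Finset D.ConnectedComponent => t ≤ (S 𝒵).card) Finset.card
    ⟨Finset.univ.erase c₀, by
      have := hbig c₀
      simp only [Finset.mem_filter, Finset.mem_univ, true_and]
      linarith⟩
  simp only [Finset.mem_filter, Finset.mem_univ, true_and] at h𝒵 hmin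
  have hne : 𝒵.Nonempty := by
    rw [Finset.nonempty_iff_ne_empty]
    rintro rfl
    have : S ∅ = ∅ := by
      ext v; simp [hSmem]
    rw [this] at h𝒵
    simp at h𝒵
    linarith
  obtain ⟨c, hc⟩ := hne
  have h1 : ((S (𝒵.erase c)).card : ℝ) < t := by
    by_contra hcon
    have := hmin _ (not_lt.1 hcon)
    have := Finset.card_erase_lt_of_mem hc
    omega
  have h2 : ((S 𝒵ᶜ).card : ℝ) < t := by
    by_contra hcon
    obtain ⟨a, ha, b, hb, hab⟩ := hconn (S 𝒵) (S 𝒵ᶜ) (by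
      rw [Finset.disjoint_left]
      intro x hx hx'
      obtain ⟨_, h⟩ := (hSmem _ _).1 hx
      obtain ⟨_, h'⟩ := (hSmem _ _).1 hx'
      exact (Finset.mem_compl.1 h') h) h𝒵 (not_lt.1 hcon)
    obtain ⟨hbU, h'⟩ := (hSmem _ _).1 hb
    rcases hclosed _ a ha b hab with h | h
    · obtain ⟨_, h⟩ := (hSmem _ _).1 h
      exact (Finset.mem_compl.1 h') h
    · exact (hverts b).1 hbU (by simpa using h)
  have h3 : S (Finset.univ.erase c) ⊆ S (𝒵.erase c) ∪ S 𝒵ᶜ := by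
    intro x hx
    obtain ⟨h, hx⟩ := (hSmem _ _).1 hx
    rw [Finset.mem_union, hSmem, hSmem]
    by_cases hx' : D.connectedComponentMk ⟨x, h⟩ ∈ 𝒵
    · left; exact ⟨h, Finset.mem_erase.2 ⟨(Finset.mem_erase.1 hx).1, hx'⟩⟩
    · right; exact ⟨h, Finset.mem_compl.2 hx'⟩
  have h4 : ((S (Finset.univ.erase c)).card : ℝ) ≤ (S (𝒵.erase c)).card + (S 𝒵ᶜ).card := by
    exact_mod_cast (Finset.card_le_card h3).trans (Finset.card_union_le _ _)
  linarith [hbig c]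

/-- A family of finite sets of size at least `4 * k` admits a two-colouring in which each set has at
least `k` elements of each colour, provided the family is not too large. -/
lemma exists_balanced_coloring {ι α : Type} [Fintype ι] [Fintype α] (R : ι → Finset α) (k : ℕ)
    (hR : ∀ i, 4 * k ≤ (R i).card) (hk : 2 * (Fintype.card ι : ℝ) * (81 / 128) ^ k < 1) :
    ∃ f : α → Bool, ∀ i b, k ≤ ((R i).filter fun w => f w = b).card := by
  by_contra! hcon
  let W : ι × Bool → (α → Bool) → ℝ := fun j f =>
    ∏ w, if w ∈ R j.1 ∧ f w = j.2 then (1 / 2 : ℝ) else 1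
  have hW : ∀ j f, W j f = (1 / 2) ^ ((R j.1).filter fun w => f w = j.2).card := by
    intro j f
    simp only [W]
    rw [← Finset.prod_filter, Finset.prod_const]
    congr 2
    ext w; simp
  have hsum : ∀ j, ∑ f, W j f ≤ 2 ^ Fintype.card α * (3 / 4) ^ (4 * k) := by
    intro j
    have h1 : ∑ f, W j f = ∏ w, ∑ c : Bool, if w ∈ R j.1 ∧ c = j.2 then (1 / 2 : ℝ) else 1 := by
      rw [Finset.prod_univ_sum, Fintype.piFinset_univ]
    have h2 : ∀ w, (∑ c : Bool, if w ∈ R j.1 ∧ c = j.2 then (1 / 2 : ℝ) else 1) =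
        2 * if w ∈ R j.1 then 3 / 4 else 1 := by
      intro w
      by_cases hw : w ∈ R j.1 <;> rcases j with ⟨i, _ | _⟩ <;> simp_all <;> norm_num
    rw [h1, Finset.prod_congr rfl fun w _ => h2 w, Finset.prod_mul_distrib, Finset.prod_const,
      Finset.card_univ, ← Finset.prod_filter, Finset.prod_const, Finset.filter_univ_mem]
    exact mul_le_mul_of_nonneg_left
      (pow_le_pow_of_le_one (by norm_num) (by norm_num) (hR j.1)) (by positivity)
  have hlow : ∀ f : α → Bool, (1 / 2 : ℝ) ^ k ≤ ∑ j, W j f := by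
    intro f
    obtain ⟨i, b, hib⟩ := hcon f
    calc (1 / 2 : ℝ) ^ k ≤ W (i, b) f := by
          rw [hW]
          exact pow_le_pow_of_le_one (by norm_num) (by norm_num) hib.le
      _ ≤ _ := Finset.single_le_sum (f := fun j => W j f)
          (fun j _ => by rw [hW]; positivity) (Finset.mem_univ _)
  have h1 : (2 : ℝ) ^ Fintype.card α * (1 / 2) ^ k ≤
      (2 * Fintype.card ι) * (2 ^ Fintype.card α * (3 / 4) ^ (4 * k)) := by
    calc (2 : ℝ) ^ Fintype.card α * (1 / 2) ^ k = ∑ _f : α → Bool, (1 / 2 : ℝ) ^ k := by simp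
      _ ≤ ∑ f : α → Bool, ∑ j, W j f := Finset.sum_le_sum fun f _ => hlow f
      _ = ∑ j, ∑ f, W j f := Finset.sum_comm
      _ ≤ ∑ _j : ι × Bool, (2 : ℝ) ^ Fintype.card α * (3 / 4) ^ (4 * k) :=
          Finset.sum_le_sum fun j _ => hsum j
      _ = _ := by simp; ring
  have h2 : (81 / 128 : ℝ) ^ k = 2 ^ k * (3 / 4) ^ (4 * k) := by
    rw [pow_mul, ← mul_pow]; norm_num
  have h3 : (1 : ℝ) = 2 ^ k * (1 / 2) ^ k := by
    rw [← mul_pow]; norm_num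
  rw [h2] at hk
  have h4 : (0 : ℝ) < 2 ^ Fintype.card α := by positivity
  have h5 : (1 / 2 : ℝ) ^ k ≤ 2 * Fintype.card ι * (3 / 4) ^ (4 * k) := by
    refine le_of_mul_le_mul_left ?_ h4
    linarith
  have h6 := mul_le_mul_of_nonneg_left h5 (show (0 : ℝ) ≤ 2 ^ k by positivity)
  rw [← h3] at h6
  linarith

lemma deg_eq_card_filter {n : ℕ} (G : SimpleGraph (Fin n)) (v : Fin n) :
    deg G v = (Finset.univ.filter (G.Adj v)).card := by
  rw [deg, Set.ncard_eq_toFinset_card']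
  congr 1
  ext w; simp

lemma deg_eq_zero_of_forall_not_adj {n : ℕ} {G : SimpleGraph (Fin n)} {v : Fin n}
    (h : ∀ w, ¬ G.Adj v w) : deg G v = 0 := by
  rw [deg_eq_card_filter, Finset.card_eq_zero, Finset.filter_eq_empty_iff]
  exact fun w _ => h w

lemma sum_deg_even {n : ℕ} (G : SimpleGraph (Fin n)) : Even (∑ v, deg G v) := by
  have h := G.sum_degrees_eq_twice_card_edges
  have h2 : ∀ v, deg G v = G.degree v := by
    intro v
    rw [deg_eq_card_filter, ← SimpleGraph.card_neighborFinset_eq_degree]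
    congr 1
    ext w; simp
  rw [Finset.sum_congr rfl fun v _ => h2 v, h]
  exact even_two_mul _

lemma two_mul_eIn {n : ℕ} (G : SimpleGraph (Fin n)) (S : Finset (Fin n)) :
    2 * eIn G S = ∑ v ∈ S, (S.filter (G.Adj v)).card := by
  let G' : SimpleGraph (Fin n) :=
    { Adj := fun a b => G.Adj a b ∧ a ∈ S ∧ b ∈ S
      symm := ⟨fun a b h => ⟨h.1.symm, h.2.2, h.2.1⟩⟩
      loopless := ⟨fun a h => G.loopless.irrefl a h.1⟩ }
  have h1 : eIn G S = G'.edgeFinset.card := by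
    rw [eIn, Set.ncard_eq_toFinset_card']
    congr 1
    ext e
    induction e with
    | _ a b => simp [G']
  rw [h1, ← G'.sum_degrees_eq_twice_card_edges, ← Finset.sum_subset (Finset.subset_univ S)]
  · refine Finset.sum_congr rfl fun v hv => ?_
    rw [← SimpleGraph.card_neighborFinset_eq_degree]
    congr 1
    ext w
    simp [G', hv, and_comm]
  · intro v _ hv
    rw [← SimpleGraph.card_neighborFinset_eq_degree, Finset.card_eq_zero]
    ext w
    simp [G', hv]

lemma eIn_union {n : ℕ} (G : SimpleGraph (Fin n)) {S T : Finset (Fin n)}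
    (h : Disjoint S T) :
    eIn G (S ∪ T : Finset (Fin n)) = eIn G S + eIn G T + ∑ v ∈ S, (T.filter (G.Adj v)).card := by
  have h1 := two_mul_eIn G S
  have h2 := two_mul_eIn G T
  have h3 := two_mul_eIn G (S ∪ T)
  have h4 : ∀ v, ((S ∪ T).filter (G.Adj v)).card =
      (S.filter (G.Adj v)).card + (T.filter (G.Adj v)).card := by
    intro v
    rw [Finset.filter_union, Finset.card_union_of_disjoint (Finset.disjoint_filter_filter h)]
  have h5 : ∑ v ∈ S, (T.filter (G.Adj v)).card = ∑ v ∈ T, (S.filter (G.Adj v)).card := by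
    have h6 := Finset.sum_card_bipartiteAbove_eq_sum_card_bipartiteBelow (s := S) (t := T) G.Adj
    simpa [Finset.bipartiteAbove, Finset.bipartiteBelow, G.adj_comm] using h6
  rw [Finset.sum_union h, Finset.sum_congr rfl fun v _ => h4 v,
    Finset.sum_congr (s₁ := T) rfl fun v _ => h4 v, Finset.sum_add_distrib,
    Finset.sum_add_distrib] at h3
  omega

lemma IsJumbled.exists_adj {n : ℕ} {G H : SimpleGraph (Fin n)} {p β m t : ℝ}
    (hG : IsJumbled G p β) (hHG : H ≤ G) (hp : 0 ≤ p) (hβ : 0 ≤ β)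
    (hm : ∀ v, (deg G v : ℝ) ≤ deg H v + m) (ht : 0 < t) (hpt : m + 2 * β * n / t < p * t)
    {Z₁ Z₂ : Finset (Fin n)} (hdisj : Disjoint Z₁ Z₂) (h₁ : t ≤ Z₁.card) (h₂ : t ≤ Z₂.card) :
    ∃ a ∈ Z₁, ∃ b ∈ Z₂, H.Adj a b := by
  by_contra! hcon
  have hup : ∀ v ∈ Z₁, ((Z₂.filter (G.Adj v)).card : ℝ) ≤ m := by
    intro v hv
    have h1 : (Z₂.filter (G.Adj v)).card + (Finset.univ.filter (H.Adj v)).card ≤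
        (Finset.univ.filter (G.Adj v)).card := by
      rw [← Finset.card_union_of_disjoint]
      · apply Finset.card_le_card
        intro w hw
        simp only [Finset.mem_union, Finset.mem_filter, Finset.mem_univ, true_and] at hw ⊢
        exact hw.elim (fun h => h.2) (fun h => hHG h)
      · rw [Finset.disjoint_left]
        intro w hw hw'
        simp only [Finset.mem_filter, Finset.mem_univ, true_and] at hw hw'
        exact hcon v hv w hw.1 hw'
    rw [← deg_eq_card_filter, ← deg_eq_card_filter] at h1
    have h2 : ((Z₂.filter (G.Adj v)).card : ℝ) + deg H v ≤ deg G v := by exact_mod_cast h1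
    linarith [hm v]
  have hsum : (∑ v ∈ Z₁, ((Z₂.filter (G.Adj v)).card : ℝ)) ≤ Z₁.card * m := by
    calc _ ≤ ∑ v ∈ Z₁, m := Finset.sum_le_sum hup
      _ = _ := by simp
  have heq : (eIn G (Z₁ ∪ Z₂ : Finset (Fin n)) : ℝ) = eIn G Z₁ + eIn G Z₂ +
      ∑ v ∈ Z₁, ((Z₂.filter (G.Adj v)).card : ℝ) := by
    exact_mod_cast eIn_union G hdisj
  have j1 := abs_le.1 (hG (Z₁ : Set (Fin n)))
  have j2 := abs_le.1 (hG (Z₂ : Set (Fin n)))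
  have j3 := abs_le.1 (hG ((Z₁ ∪ Z₂ : Finset (Fin n)) : Set (Fin n)))
  simp only [Set.ncard_coe_finset] at j1 j2 j3
  have hc : ((Z₁ ∪ Z₂).card : ℝ) = Z₁.card + Z₂.card := by
    exact_mod_cast Finset.card_union_of_disjoint hdisj
  have hn : (Z₁.card : ℝ) + Z₂.card ≤ n := by
    rw [← hc]
    exact_mod_cast (Finset.card_le_univ _).trans_eq (Fintype.card_fin n)
  rw [hc] at j3
  set x : ℝ := (Z₁.card : ℝ)
  set y : ℝ := (Z₂.card : ℝ)
  have hβn := mul_le_mul_of_nonneg_left hn hβ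
  have key : p * x * y ≤ x * m + 2 * β * n := by nlinarith [j1.2, j2.2, j3.1]
  have hx : 0 < x := by linarith
  have h3 : 2 * β * n ≤ x * (2 * β * n / t) := by
    have h0 : 0 ≤ 2 * β * n := by positivity
    calc 2 * β * n = t * (2 * β * n / t) := by field_simp
      _ ≤ _ := mul_le_mul_of_nonneg_right h₁ (by positivity)
  have h4 : p * x * t ≤ p * x * y := mul_le_mul_of_nonneg_left h₂ (by positivity)
  have h5 := mul_lt_mul_of_pos_left hpt hx
  nlinarith

lemma IsJumbled.le_card {n : ℕ} {G H : SimpleGraph (Fin n)} {p β d : ℝ}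
    (hG : IsJumbled G p β) (hHG : H ≤ G) (hp : 0 ≤ p) (hβ : 0 ≤ β)
    {X U : Finset (Fin n)} (hX : X.Nonempty) (hUX : U.card ≤ X.card)
    (hd : ∀ v ∈ X, d ≤ ((X ∪ U).filter (H.Adj v)).card) :
    d ≤ 4 * p * X.card + 4 * β := by
  have h1 : (X.card : ℝ) * d ≤ 2 * eIn G (X ∪ U : Finset (Fin n)) := by
    have h2 : (2 * eIn G (X ∪ U : Finset (Fin n)) : ℝ) =
        ∑ v ∈ X ∪ U, (((X ∪ U).filter (G.Adj v)).card : ℝ) := by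
      exact_mod_cast two_mul_eIn G (X ∪ U)
    rw [h2]
    calc (X.card : ℝ) * d = ∑ v ∈ X, d := by simp
      _ ≤ ∑ v ∈ X, (((X ∪ U).filter (H.Adj v)).card : ℝ) := Finset.sum_le_sum hd
      _ ≤ ∑ v ∈ X, (((X ∪ U).filter (G.Adj v)).card : ℝ) := by
          refine Finset.sum_le_sum fun v _ => ?_
          exact_mod_cast Finset.card_le_card (Finset.monotone_filter_right _ fun w _ h => hHG h)
      _ ≤ _ := Finset.sum_le_sum_of_subset_of_nonneg Finset.subset_union_left
          fun _ _ _ => by positivity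
  have j := (abs_le.1 (hG ((X ∪ U : Finset (Fin n)) : Set (Fin n)))).2
  rw [Set.ncard_coe_finset] at j
  have hc : ((X ∪ U).card : ℝ) ≤ 2 * X.card := by
    have := Finset.card_union_le X U
    exact_mod_cast (by omega : (X ∪ U).card ≤ 2 * X.card)
  have hx : (0 : ℝ) < X.card := by exact_mod_cast hX.card_pos
  set x : ℝ := (X.card : ℝ)
  set s : ℝ := ((X ∪ U).card : ℝ)
  have hs : 0 ≤ s := by positivity
  have h3 : p * (s * (s - 1) / 2) ≤ p * (2 * x ^ 2) :=
    mul_le_mul_of_nonneg_left (by nlinarith) hp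
  have h4 : β * s ≤ β * (2 * x) := mul_le_mul_of_nonneg_left hc hβ
  have h5 : x * d ≤ x * (4 * p * x + 4 * β) := by nlinarith
  exact le_of_mul_le_mul_left h5 hx

/-- `P` is a perfect matching of the vertex set `A`. -/
def IsMatchingOn {n : ℕ} (P : SimpleGraph (Fin n)) (A : Finset (Fin n)) : Prop :=
  (∀ v ∈ A, deg P v = 1) ∧ ∀ u v, P.Adj u v → u ∈ A

lemma IsMatchingOn.deg_eq_zero {n : ℕ} {P : SimpleGraph (Fin n)} {A : Finset (Fin n)}
    (h : IsMatchingOn P A) {v : Fin n} (hv : v ∉ A) : deg P v = 0 :=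
  deg_eq_zero_of_forall_not_adj fun w hw => hv (h.2 v w hw)

lemma IsJumbled.exists_isMatchingOn {n : ℕ} {G H : SimpleGraph (Fin n)} {p β m t d : ℝ}
    (hG : IsJumbled G p β) (hHG : H ≤ G) (hp : 0 ≤ p) (hβ : 0 ≤ β)
    (hm : ∀ v, (deg G v : ℝ) ≤ deg H v + m) (ht : 0 < t) (hpt : m + 2 * β * n / t < p * t)
    (hd : 4 * p * (2 * t) + 4 * β < d) (A : Finset (Fin n)) (hA : Even A.card)
    (hdA : ∀ v ∈ A, d ≤ (A.filter (H.Adj v)).card) :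
    ∃ P ≤ H, IsMatchingOn P A := by
  let ε : {x // x ∈ A} ↪ Fin n := Function.Embedding.subtype _
  obtain ⟨P, hP⟩ := exists_isPerfectMatching_of_expansion (V := {x // x ∈ A}) (H.comap ε)
    (by simpa using hA) t ht (by
      intro X U _ hX hUX hXU
      by_contra! hlt
      have h1 := hG.le_card (d := d) (X := X.map ε) (U := U.map ε) hHG hp hβ (by simpa using hX)
        (by simpa using hUX) (by
          intro v hv
          obtain ⟨x, hx, rfl⟩ := Finset.mem_map.1 hv
          refine (hdA _ x.2).trans ?_
          norm_cast
          apply Finset.card_le_card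
          intro w hw
          obtain ⟨hw, hxw⟩ := Finset.mem_filter.1 hw
          rw [Finset.mem_filter, Finset.mem_union]
          refine ⟨?_, hxw⟩
          rcases hXU x hx ⟨w, hw⟩ hxw with h | h
          · exact Or.inl (Finset.mem_map.2 ⟨_, h, rfl⟩)
          · exact Or.inr (Finset.mem_map.2 ⟨_, h, rfl⟩))
      rw [Finset.card_map] at h1
      have h2 : 4 * p * X.card ≤ 4 * p * (2 * t) :=
        mul_le_mul_of_nonneg_left hlt.le (by positivity)
      linarith)
    (by
      intro Z₁ Z₂ hdisj h₁ h₂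
      obtain ⟨a, ha, b, hb, hab⟩ := hG.exists_adj (Z₁ := Z₁.map ε) (Z₂ := Z₂.map ε) hHG hp hβ hm
        ht hpt ((Finset.disjoint_map _).2 hdisj) (by simpa using h₁) (by simpa using h₂)
      obtain ⟨a, ha', rfl⟩ := Finset.mem_map.1 ha
      obtain ⟨b, hb', rfl⟩ := Finset.mem_map.1 hb
      exact ⟨a, ha', b, hb', hab⟩)
  rw [SimpleGraph.Subgraph.isPerfectMatching_iff] at hP
  refine ⟨P.spanningCoe.map ε, ?_, ?_, ?_⟩
  · rintro _ _ ⟨-, a, b, hab, rfl, rfl⟩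
    exact P.adj_sub hab
  · intro v hv
    obtain ⟨w, hw, huniq⟩ := hP ⟨v, hv⟩
    rw [deg_eq_card_filter, Finset.card_eq_one]
    refine ⟨w, ?_⟩
    ext z
    simp only [Finset.mem_filter, Finset.mem_univ, true_and, Finset.mem_singleton]
    constructor
    · intro hvz
      rw [SimpleGraph.map_adj] at hvz
      obtain ⟨a, b, hab, ha, rfl⟩ := hvz
      obtain rfl : a = ⟨v, hv⟩ := Subtype.ext ha
      rw [← huniq b hab]; rfl
    · rintro rfl
      rw [SimpleGraph.map_adj]
      exact ⟨_, _, hw, rfl, rfl⟩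
  · intro u v huv
    rw [SimpleGraph.map_adj] at huv
    obtain ⟨a, b, -, rfl, rfl⟩ := huv
    exact a.2

lemma deg_sup_of_disjoint {n : ℕ} {P Q : SimpleGraph (Fin n)} (h : Disjoint P Q) (v : Fin n) :
    deg (P ⊔ Q) v = deg P v + deg Q v := by
  rw [deg_eq_card_filter, deg_eq_card_filter, deg_eq_card_filter, ← Finset.card_union_of_disjoint]
  · congr 1
    ext w; simp
  · rw [Finset.disjoint_left]
    intro w hw hw'
    simp only [Finset.mem_filter, Finset.mem_univ, true_and] at hw hw'
    have : (P ⊓ Q).Adj v w := ⟨hw, hw'⟩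
    rw [disjoint_iff.1 h] at this
    exact this

lemma deg_edge {n : ℕ} {x w : Fin n} (hxw : x ≠ w) (v : Fin n) :
    deg (SimpleGraph.edge x w) v = if v = x ∨ v = w then 1 else 0 := by
  rw [deg_eq_card_filter]
  by_cases hx : v = x
  · subst hx
    rw [if_pos (Or.inl rfl), Finset.card_eq_one]
    refine ⟨w, ?_⟩
    ext z
    simp only [SimpleGraph.edge_adj, Finset.mem_filter, Finset.mem_univ, true_and,
      Finset.mem_singleton]
    grind
  by_cases hw : v = w
  · subst hw
    rw [if_pos (Or.inr rfl), Finset.card_eq_one]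
    refine ⟨x, ?_⟩
    ext z
    simp only [SimpleGraph.edge_adj, Finset.mem_filter, Finset.mem_univ, true_and,
      Finset.mem_singleton]
    grind
  · rw [if_neg (by tauto), Finset.card_eq_zero]
    ext z
    simp only [SimpleGraph.edge_adj, Finset.mem_filter, Finset.mem_univ, true_and,
      Finset.notMem_empty, iff_false]
    grind

lemma IsJumbled.exists_completion {n : ℕ} {G H M : SimpleGraph (Fin n)} {p β m t d : ℝ}
    (hG : IsJumbled G p β) (hHG : H ≤ G) (hp : 0 ≤ p) (hβ : 0 ≤ β)
    (hm : ∀ v, (deg G v : ℝ) ≤ deg H v + m) (ht : 0 < t) (hpt : m + 2 * β * n / t < p * t)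
    (hd : 4 * p * (2 * t) + 4 * β < d) (hM : ∀ v, deg M v ≤ 1) (hMH : Disjoint M H)
    (hdeg : ∀ v, d + 1 ≤ ((Finset.univ.filter (H.Adj v)).filter fun u => deg M u = 0).card) :
    ∃ P ≤ H, (Even n → IsPerfectMatchingGraph (M ⊔ P)) ∧
      (Odd n → IsPerfectPseudomatching (M ⊔ P)) ∧ ∀ v, deg P v ≤ 2 := by
  set A : Finset (Fin n) := Finset.univ.filter fun u => deg M u = 0 with hA
  have hAmem : ∀ v, v ∈ A ↔ deg M v = 0 := by simp [hA]
  have hAcard : ∃ k, n = A.card + 2 * k := by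
    obtain ⟨k, hk⟩ := sum_deg_even M
    refine ⟨k, ?_⟩
    have h1 : ∑ v, deg M v = ∑ v, if deg M v = 0 then 0 else 1 :=
      Finset.sum_congr rfl fun v _ => by have := hM v; split_ifs <;> omega
    have h2 : A.card = ∑ v, if deg M v = 0 then 1 else 0 := by
      rw [hA, Finset.card_filter]
    have h3 : A.card + ∑ v, deg M v = ∑ _v : Fin n, 1 := by
      rw [h1, h2, ← Finset.sum_add_distrib]
      exact Finset.sum_congr rfl fun v _ => by split_ifs <;> rfl
    simp at h3
    omega
  obtain ⟨k, hk⟩ := hAcard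
  have hdA : ∀ v, d + 1 ≤ (A.filter (H.Adj v)).card := by
    intro v
    refine (hdeg v).trans_eq ?_
    congr 2
    ext w; simp [hA, and_comm]
  rcases Nat.even_or_odd n with hn | hn
  · have hAe : Even A.card := by
      rw [hk] at hn
      simpa [Nat.even_add] using hn
    obtain ⟨P, hPH, hP⟩ := hG.exists_isMatchingOn hHG hp hβ hm ht hpt hd A hAe
      (fun v _ => by linarith [hdA v])
    have hdegP : ∀ v, deg M v + deg P v = 1 := by
      intro v
      by_cases hv : v ∈ A
      · rw [hP.1 v hv, (hAmem v).1 hv]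
      · rw [hP.deg_eq_zero hv]
        have := hM v
        rw [hAmem] at hv
        omega
    refine ⟨P, hPH, fun _ v => ?_, fun h => ?_, fun v => by have := hdegP v; omega⟩
    · change deg (M ⊔ P) v = 1
      rw [deg_sup_of_disjoint (hMH.mono_right hPH), hdegP]
    · exact absurd hn (Nat.not_even_iff_odd.2 h)
  · have hAo : Odd A.card := by
      rw [hk] at hn
      simpa [Nat.odd_add] using hn
    obtain ⟨x, hx⟩ := Finset.card_pos.1 hAo.pos
    have hd0 : 0 < d := lt_of_le_of_lt (by positivity) hd
    obtain ⟨w, hw⟩ : (A.filter (H.Adj x)).Nonempty := by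
      rw [← Finset.card_pos]
      have := hdA x
      have : (0 : ℝ) < (A.filter (H.Adj x)).card := by linarith
      exact_mod_cast this
    have hxw : H.Adj x w := (Finset.mem_filter.1 hw).2
    have hAe : Even (A.erase x).card := by
      rw [Finset.card_erase_of_mem hx]
      exact Nat.Odd.sub_odd hAo odd_one
    obtain ⟨Q, hQH, hQ⟩ := hG.exists_isMatchingOn hHG hp hβ hm ht hpt hd _ hAe
      (fun v _ => by
        have h1 : (A.filter (H.Adj v)).card ≤ ((A.erase x).filter (H.Adj v)).card + 1 := by
          rw [Finset.filter_erase]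
          have := Finset.pred_card_le_card_erase (a := x) (s := A.filter (H.Adj v))
          omega
        have h2 : ((A.filter (H.Adj v)).card : ℝ) ≤ ((A.erase x).filter (H.Adj v)).card + 1 := by
          exact_mod_cast h1
        linarith [hdA v])
    have hdegQ : ∀ v, deg M v + deg Q v = if v = x then 0 else 1 := by
      intro v
      by_cases hv : v ∈ A.erase x
      · rw [hQ.1 v hv, (hAmem v).1 (Finset.mem_erase.1 hv).2, if_neg (Finset.mem_erase.1 hv).1]
      · rw [hQ.deg_eq_zero hv]
        split_ifs with hvx
        · rw [hvx, (hAmem x).1 hx]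
        · have := hM v
          have : deg M v ≠ 0 := fun h => hv (Finset.mem_erase.2 ⟨hvx, (hAmem v).2 h⟩)
          omega
    have hedge : SimpleGraph.edge x w ≤ H := by
      rw [SimpleGraph.edge_le_iff]
      exact Or.inr hxw
    have hQe : Disjoint Q (SimpleGraph.edge x w) := by
      rw [disjoint_iff]
      ext a b
      simp only [SimpleGraph.inf_adj, SimpleGraph.bot_adj, iff_false, SimpleGraph.edge_adj]
      rintro ⟨hab, ⟨rfl, rfl⟩ | ⟨rfl, rfl⟩, -⟩
      · exact absurd (hQ.2 _ _ hab) (by simp)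
      · exact absurd (hQ.2 _ _ hab.symm) (by simp)
    have hPH : Q ⊔ SimpleGraph.edge x w ≤ H := sup_le hQH hedge
    have hdegP : ∀ v, deg (M ⊔ (Q ⊔ SimpleGraph.edge x w)) v = if v = w then 2 else 1 := by
      intro v
      rw [deg_sup_of_disjoint (hMH.mono_right hPH), deg_sup_of_disjoint hQe, ← add_assoc, hdegQ,
        deg_edge hxw.ne]
      have := hxw.ne
      grind
    refine ⟨_, hPH, fun h => absurd h (Nat.not_even_iff_odd.2 hn), fun _ => ⟨w, ?_, ?_⟩, ?_⟩
    · have := hdegP w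
      rwa [if_pos rfl] at this
    · intro v hv
      have := hdegP v
      rwa [if_neg hv] at this
    · intro v
      have := hdegP v
      rw [deg_sup_of_disjoint (hMH.mono_right hPH)] at this
      split_ifs at this <;> omega

/-- A matching can be split in two so that every large enough vertex set has many vertices missed by
each of the two parts. -/
lemma exists_balanced_splitting {n : ℕ} (M : SimpleGraph (Fin n)) (hM : ∀ v, deg M v ≤ 1)
    (N : Fin n → Finset (Fin n)) (k : ℕ) (hN : ∀ v, 8 * k ≤ (N v).card)
    (hk : 2 * (n : ℝ) * (81 / 128) ^ k < 1) :
    ∃ M₁ M₂ : SimpleGraph (Fin n), M₁ ⊔ M₂ = M ∧ Disjoint M₁ M₂ ∧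
      (∀ v, k ≤ ((N v).filter fun u => deg M₁ u = 0).card) ∧
      ∀ v, k ≤ ((N v).filter fun u => deg M₂ u = 0).card := by
  have huniq : ∀ u w w', M.Adj u w → M.Adj u w' → w = w' := by
    intro u w w' h h'
    have := hM u
    rw [deg_eq_card_filter, Finset.card_le_one] at this
    exact this w (by simpa using h) w' (by simpa using h')
  let m : Fin n → Fin n := fun u => if h : ∃ w, M.Adj u w then h.choose else u
  have hm : ∀ u w, M.Adj u w → m u = w := by
    intro u w h
    have hex : ∃ w, M.Adj u w := ⟨w, h⟩
    simp only [m, dif_pos hex]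
    exact huniq u _ _ hex.choose_spec h
  have hmm : ∀ u, m (m u) = u := by
    intro u
    by_cases h : ∃ w, M.Adj u w
    · obtain ⟨w, h⟩ := h
      rw [hm u w h, hm w u h.symm]
    · simp [m, dif_neg h]
  let ρ : Fin n → Fin n := fun u => min u (m u)
  have hρ : ∀ u w, M.Adj u w → ρ u = ρ w := by
    intro u w h
    simp only [ρ]
    rw [hm u w h, hm w u h.symm, min_comm]
  have hcard : ∀ v, 4 * k ≤ ((N v).image ρ).card := by
    intro v
    have h1 : (N v).card ≤ 2 * ((N v).image ρ).card := by
      refine Finset.card_le_mul_card_image (N v) 2 fun b _ => ?_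
      refine (Finset.card_le_card (t := {b, m b}) ?_).trans Finset.card_le_two
      intro u hu
      have hu := (Finset.mem_filter.1 hu).2
      rw [Finset.mem_insert, Finset.mem_singleton]
      rcases min_choice u (m u) with h | h
      · left; rw [← hu]; exact h.symm
      · right; rw [← hu]; simp only [ρ]; rw [h, hmm]
    have := hN v
    omega
  obtain ⟨f, hf⟩ := exists_balanced_coloring (fun v => (N v).image ρ) k hcard (by simpa using hk)
  let part : Bool → SimpleGraph (Fin n) := fun b =>
    { Adj := fun x y => M.Adj x y ∧ f (ρ x) = b
      symm := ⟨fun x y h => ⟨h.1.symm, by rw [← hρ x y h.1]; exact h.2⟩⟩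
      loopless := ⟨fun x h => M.loopless.irrefl x h.1⟩ }
  have hpart : ∀ b v, k ≤ ((N v).filter fun u => deg (part b) u = 0).card := by
    intro b v
    refine (hf v (!b)).trans ?_
    rw [Finset.filter_image]
    refine Finset.card_image_le.trans (Finset.card_le_card ?_)
    intro u hu
    obtain ⟨huN, hu⟩ := Finset.mem_filter.1 hu
    refine Finset.mem_filter.2 ⟨huN, deg_eq_zero_of_forall_not_adj fun w hw => ?_⟩
    have hb : f (ρ u) = b := hw.2
    cases b <;> simp_all
  refine ⟨part true, part false, ?_, ?_, hpart true, hpart false⟩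
  · ext x y
    simp only [part, SimpleGraph.sup_adj]
    cases f (ρ x) <;> simp
  · rw [disjoint_iff]
    ext x y
    simp only [part, SimpleGraph.inf_adj, SimpleGraph.bot_adj, iff_false]
    rintro ⟨⟨-, h⟩, -, h'⟩
    simp [h] at h'

lemma minDeg_le_deg {V : Type} (G : SimpleGraph V) (v : V) : minDeg G ≤ deg G v :=
  Nat.sInf_le ⟨v, rfl⟩

lemma deg_le_maxDeg {n : ℕ} (G : SimpleGraph (Fin n)) (v : Fin n) : deg G v ≤ maxDeg G :=
  le_csSup (Set.finite_range _).bddAbove ⟨v, rfl⟩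

lemma IsJumbled.mono {V : Type} {G : SimpleGraph V} {p β β' : ℝ} (h : IsJumbled G p β)
    (hβ : β ≤ β') : IsJumbled G p β' :=
  fun S => (h S).trans (mul_le_mul_of_nonneg_right hβ (Nat.cast_nonneg _))

lemma two_mul_mul_pow_lt_one {x L : ℝ} {k : ℕ} (hx : 0 < x) (hL : Real.log x = L)
    (hk : 1 + L < 47 / 128 * k) : 2 * x * (81 / 128) ^ k < 1 := by
  have h1 : (81 / 128 : ℝ) ≤ Real.exp (-(47 / 128)) := by
    have := Real.add_one_le_exp (-(47 / 128 : ℝ))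
    linarith
  have h2 : (2 : ℝ) ≤ Real.exp 1 := by
    have := Real.add_one_le_exp (1 : ℝ)
    linarith
  have h3 : x = Real.exp L := by rw [← hL, Real.exp_log hx]
  calc 2 * x * (81 / 128) ^ k ≤ Real.exp 1 * Real.exp L * Real.exp (-(47 / 128)) ^ k := by
        rw [← h3]; gcongr
    _ = Real.exp (1 + L - 47 / 128 * k) := by
        rw [← Real.exp_nat_mul, ← Real.exp_add, ← Real.exp_add]; congr 1; ring
    _ < 1 := by rw [Real.exp_lt_one_iff]; linarith

lemma deg_le_of_le_sup {n : ℕ} {H H' P : SimpleGraph (Fin n)} (h : H ≤ H' ⊔ P) (v : Fin n) :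
    deg H v ≤ deg H' v + deg P v := by
  rw [deg_eq_card_filter, deg_eq_card_filter, deg_eq_card_filter]
  refine (Finset.card_le_card ?_).trans (Finset.card_union_le _ _)
  intro w hw
  simp only [Finset.mem_union, Finset.mem_filter, Finset.mem_univ, true_and] at hw ⊢
  have : H.Adj v w → H'.Adj v w ∨ P.Adj v w := fun hvw => h hvw
  tauto

lemma card_filter_le_of_le_sup {n : ℕ} {H H' P : SimpleGraph (Fin n)} (h : H ≤ H' ⊔ P)
    (q : Fin n → Prop) [DecidablePred q] (v : Fin n) :
    ((Finset.univ.filter (H.Adj v)).filter q).card ≤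
      ((Finset.univ.filter (H'.Adj v)).filter q).card + deg P v := by
  rw [deg_eq_card_filter]
  refine (Finset.card_le_card ?_).trans (Finset.card_union_le _ _)
  intro w hw
  simp only [Finset.mem_union, Finset.mem_filter, Finset.mem_univ, true_and] at hw ⊢
  have : H.Adj v w → H'.Adj v w ∨ P.Adj v w := fun hvw => h hvw
  tauto

end EDHC

open EDHC in
/-- Lemma 6.6 (HalfMatch). -/
theorem stmt_15 :
    ∃ N : ℕ, ∀ n : ℕ, N ≤ n →
      ∀ (rG : ℝ) (G H M : SimpleGraph (Fin n)),
      IsPseudorandom n G (rG / n) → (Real.log n) ^ 2 ≤ rG →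
      H ≤ G → 549 / 550 * rG + 5 ≤ (minDeg H : ℝ) →
      (∀ v, deg M v ≤ 1) → Disjoint M.edgeSet H.edgeSet →
      ∃ M₁ M₂ : SimpleGraph (Fin n), M₁ ⊔ M₂ = M ∧ Disjoint M₁.edgeSet M₂.edgeSet ∧
        ∃ E₁ E₂ : Set (Sym2 (Fin n)), E₁ ⊆ H.edgeSet ∧ E₂ ⊆ H.edgeSet ∧ Disjoint E₁ E₂ ∧
          (Even n →
            IsPerfectMatchingGraph (M₁ ⊔ SimpleGraph.fromEdgeSet E₁) ∧
            IsPerfectMatchingGraph (M₂ ⊔ SimpleGraph.fromEdgeSet E₂)) ∧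
          (Odd n →
            IsPerfectPseudomatching (M₁ ⊔ SimpleGraph.fromEdgeSet E₁) ∧
            IsPerfectPseudomatching (M₂ ⊔ SimpleGraph.fromEdgeSet E₂)) := by
  refine ⟨⌈Real.exp (10 ^ 6)⌉₊, fun n hn r G H M hG hr hHG hH hM hMH => ?_⟩
  have hexp : Real.exp (10 ^ 6) ≤ n := (Nat.le_ceil _).trans (by exact_mod_cast hn)
  have hn0 : (0 : ℝ) < n := (Real.exp_pos _).trans_le hexp
  have hL : (10 : ℝ) ^ 6 ≤ Real.log n := (Real.le_log_iff_exp_le hn0).2 hexp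
  obtain ⟨hJ, -, -, ⟨-, -, hΔ⟩, -⟩ := hG
  set L := Real.log n with hLdef
  have hr0 : 0 < r := by nlinarith
  have hr12 : (10 : ℝ) ^ 12 ≤ r := by nlinarith
  have hrL : 10 ^ 6 * L ≤ r := by nlinarith
  have hnp : (n : ℝ) * (r / n) = r := by field_simp
  have hp : 0 ≤ r / n := by positivity
  have hsqrt : √r ≤ r / 10 ^ 6 := by
    rw [Real.sqrt_le_left (by positivity)]
    nlinarith
  have hsqrtL : √(r * L) ≤ r / 10 ^ 3 := by
    rw [Real.sqrt_le_left (by positivity)]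
    nlinarith
  rw [hnp] at hJ hΔ
  have hJ' : IsJumbled G (r / n) (2 * √r) := by
    refine hJ.mono ?_
    have : √(r * (1 - r / n)) ≤ √r := Real.sqrt_le_sqrt (by nlinarith)
    linarith
  have hdegH : ∀ v, 549 / 550 * r + 5 ≤ (deg H v : ℝ) := fun v =>
    hH.trans (by exact_mod_cast minDeg_le_deg H v)
  have hdegG : ∀ v, (deg G v : ℝ) ≤ r + r / 500 := fun v => by
    have : (deg G v : ℝ) ≤ maxDeg G := by exact_mod_cast deg_le_maxDeg G v
    linarith
  set k := ⌊r / 9⌋₊ with hkdef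
  have hk1 : (k : ℝ) ≤ r / 9 := Nat.floor_le (by positivity)
  have hk2 : r / 9 < k + 1 := Nat.lt_floor_add_one _
  obtain ⟨M₁, M₂, hsup, hdisj, hc₁, hc₂⟩ := exists_balanced_splitting M hM
    (fun v => Finset.univ.filter (H.Adj v)) k
    (fun v => by
      rw [← deg_eq_card_filter]
      have : (8 * k : ℝ) ≤ deg H v := by linarith [hdegH v]
      exact_mod_cast this)
    (two_mul_mul_pow_lt_one hn0 hLdef.symm (by linarith))
  have hle₁ : M₁ ≤ M := hsup ▸ le_sup_left
  have hle₂ : M₂ ≤ M := hsup ▸ le_sup_right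
  have hdeg_mono : ∀ {M' : SimpleGraph (Fin n)}, M' ≤ M → ∀ v, deg M' v ≤ 1 := by
    intro M' h v
    refine (Set.ncard_le_ncard ?_ (Set.toFinite _)).trans (hM v)
    exact fun w hw => h hw
  rw [SimpleGraph.disjoint_edgeSet] at hMH
  have ht : (0 : ℝ) < n / 80 := by positivity
  have hpt : r / n * (n / 80) = r / 80 := by field_simp
  have hβt : 2 * (2 * √r) * n / (n / 80) = 320 * √r := by field_simp; ring
  have hpt' : (r / 550 + r / 500 + 2) + 2 * (2 * √r) * n / (n / 80) < r / n * (n / 80) := by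
    rw [hpt, hβt]; linarith
  have hd : 4 * (r / n) * (2 * (n / 80)) + 4 * (2 * √r) < (k : ℝ) - 3 := by
    have : 4 * (r / n) * (2 * (n / 80)) = r / 10 := by field_simp; ring
    rw [this]; linarith
  obtain ⟨P₁, hP₁H, hP₁e, hP₁o, hP₁d⟩ := hJ'.exists_completion (M := M₁) hHG hp (by positivity)
    (fun v => by linarith [hdegG v, hdegH v]) ht hpt' hd (hdeg_mono hle₁) (hMH.mono_left hle₁)
    (fun v => by
      have : (k : ℝ) ≤ ((Finset.univ.filter (H.Adj v)).filter fun u => deg M₁ u = 0).card := by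
        exact_mod_cast hc₁ v
      linarith)
  obtain ⟨H', hH'H, hdisjP, hsplit⟩ : ∃ H' ≤ H, Disjoint P₁ H' ∧ H ≤ H' ⊔ P₁ :=
    ⟨H \ P₁, sdiff_le, disjoint_sdiff_self_right, le_sdiff_sup⟩
  obtain ⟨P₂, hP₂H, hP₂e, hP₂o, -⟩ := hJ'.exists_completion (H := H') (M := M₂)
    (hH'H.trans hHG) hp (by positivity)
    (fun v => by
      have h1 : (deg H v : ℝ) ≤ deg H' v + 2 := by
        exact_mod_cast (deg_le_of_le_sup hsplit v).trans (Nat.add_le_add_left (hP₁d v) _)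
      linarith [hdegG v, hdegH v]) ht hpt' hd (hdeg_mono hle₂)
    ((hMH.mono_left hle₂).mono_right hH'H)
    (fun v => by
      have h1 : (k : ℝ) ≤
          ((Finset.univ.filter (H'.Adj v)).filter fun u => deg M₂ u = 0).card + 2 := by
        exact_mod_cast (hc₂ v).trans ((card_filter_le_of_le_sup hsplit _ v).trans
          (Nat.add_le_add_left (hP₁d v) _))
      linarith)
  refine ⟨M₁, M₂, hsup, SimpleGraph.disjoint_edgeSet.2 hdisj, P₁.edgeSet, P₂.edgeSet,
    SimpleGraph.edgeSet_subset_edgeSet.2 hP₁H,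
    SimpleGraph.edgeSet_subset_edgeSet.2 (hP₂H.trans hH'H),
    SimpleGraph.disjoint_edgeSet.2 (hdisjP.mono_right hP₂H), ?_, ?_⟩
  · intro h
    simpa only [SimpleGraph.fromEdgeSet_edgeSet] using ⟨hP₁e h, hP₂e h⟩
  · intro h
    simpa only [SimpleGraph.fromEdgeSet_edgeSet] using ⟨hP₁o h, hP₂o h⟩
end
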